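/- arXiv:1612.08819 — 3 statements merged into one kernel-verified Lean document; each statement's English description precedes it below -/
import Mathlib

section
/- Let 0 < α < 1, 1 ≤ q ≤ p < ∞, 1 < t ≤ s < ∞ with 1/s = 1/p − α/n and 1/t = 1/q − α/n. Let K : ℝⁿ \ {0} → ℂ be measurable with |K(z)| ≤ A |z|^{−n} for all z ≠ 0, and let b ∈ Lip_α(ℝⁿ). For f ∈ M^p_q, define the commutator C_b f(x) := ∫_{ℝⁿ} (b(x) − b(y)) K(x−y) f(y) dy (the integral converges absolutely for almost every x). Then ‖C_b f‖_{WM^s_t} ≤ C A ‖b‖_{Lip_α} ‖f‖_{M^p_q}, where C depends only on n, α, p, q. -/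
open MeasureTheory ENNReal

noncomputable section

/-- `ℝⁿ` with the Euclidean norm. -/
abbrev En (n : ℕ) := EuclideanSpace ℝ (Fin n)

/-- The open cube in `ℝⁿ` centered at `c` with half side length `r`. -/
def cube {n : ℕ} (c : En n) (r : ℝ) : Set (En n) := {y | ∀ i, |y i - c i| < r}

/-- Morrey norm `‖f‖_{M^p_q}`. -/
def morreyNorm {n : ℕ} (p q : ℝ) (f : En n → ℂ) : ℝ≥0∞ :=
  ⨆ (c : En n) (r : ℝ) (_ : 0 < r),
    volume (cube c r) ^ (1 / p - 1 / q) *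
      (∫⁻ y in cube c r, (‖f y‖₊ : ℝ≥0∞) ^ q) ^ (1 / q)

/-- Weak Morrey norm `‖f‖_{WM^p_q}`. -/
def weakMorreyNorm {n : ℕ} (p q : ℝ) (f : En n → ℂ) : ℝ≥0∞ :=
  ⨆ (c : En n) (r : ℝ) (_ : 0 < r),
    volume (cube c r) ^ (1 / p - 1 / q) *
      ⨆ (t : ℝ) (_ : 0 < t),
        (ENNReal.ofReal t ^ q * volume {y ∈ cube c r | t < ‖f y‖}) ^ (1 / q)

/-- Weak Lebesgue quasinorm `‖f‖_{L^{p,∞}}`. -/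
def weakLpNorm {n : ℕ} (p : ℝ) (f : En n → ℂ) : ℝ≥0∞ :=
  ⨆ (t : ℝ) (_ : 0 < t),
    ENNReal.ofReal t * volume {x : En n | t < ‖f x‖} ^ (1 / p)

/-- The average `b_Q` of `b` over the cube `Q = cube c r`. -/
def cubeAvg {n : ℕ} (b : En n → ℝ) (c : En n) (r : ℝ) : ℝ :=
  (∫ x in cube c r, b x) / (volume (cube c r)).toReal

/-- The BMO seminorm `‖b‖_*`. -/
def bmoSeminorm {n : ℕ} (b : En n → ℝ) : ℝ≥0∞ :=
  ⨆ (c : En n) (r : ℝ) (_ : 0 < r),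
    (volume (cube c r))⁻¹ *
      ∫⁻ x in cube c r, (‖b x - cubeAvg b c r‖₊ : ℝ≥0∞)

/-- The Lipschitz (Hölder) seminorm `‖b‖_{Lip_α}`. -/
def lipSeminorm {n : ℕ} (α : ℝ) (b : En n → ℝ) : ℝ≥0∞ :=
  ⨆ (x : En n) (y : En n) (_ : x ≠ y),
    (‖b x - b y‖₊ : ℝ≥0∞) / edist x y ^ α

/-- `sup_Q |Q|^{-(1+α/n)} ∫_Q |b - b_Q|`. -/
def lipAvgNorm {n : ℕ} (α : ℝ) (b : En n → ℝ) : ℝ≥0∞ :=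
  ⨆ (c : En n) (r : ℝ) (_ : 0 < r),
    volume (cube c r) ^ (-(1 + α / (n : ℝ))) *
      ∫⁻ x in cube c r, (‖b x - cubeAvg b c r‖₊ : ℝ≥0∞)

namespace CommAux

lemma cube_eq {n : ℕ} (c : En n) (r : ℝ) :
    cube c r = (WithLp.ofLp : En n → (Fin n → ℝ)) ⁻¹'
      (Set.univ.pi fun i => Set.Ioo (c i - r) (c i + r)) := by
  ext y
  simp only [cube, Set.mem_ofPred_eq, Set.mem_preimage, Set.mem_pi, Set.mem_univ, true_imp_iff,
    Set.mem_Ioo, abs_lt]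
  refine forall_congr' fun i => ?_
  constructor <;> rintro ⟨h1, h2⟩ <;> constructor <;> linarith

lemma measurableSet_cube {n : ℕ} (c : En n) (r : ℝ) : MeasurableSet (cube c r) := by
  rw [cube_eq]
  exact (PiLp.volume_preserving_ofLp (Fin n)).measurable
    (MeasurableSet.univ_pi fun i => measurableSet_Ioo)

lemma volume_cube {n : ℕ} (c : En n) (r : ℝ) (hr : 0 < r) :
    volume (cube c r) = ENNReal.ofReal ((2 * r) ^ (n : ℝ)) := by
  rw [cube_eq, (PiLp.volume_preserving_ofLp (Fin n)).measure_preimage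
    (MeasurableSet.univ_pi fun i => measurableSet_Ioo).nullMeasurableSet, Real.volume_pi_Ioo]
  have : ∀ i : Fin n, c i + r - (c i - r) = 2 * r := fun i => by ring
  simp only [this, Finset.prod_const, Finset.card_univ, Fintype.card_fin, Real.rpow_natCast]
  rw [ENNReal.ofReal_pow (by positivity)]

lemma volume_cube_rpow {n : ℕ} (c : En n) (r : ℝ) (hr : 0 < r) (e : ℝ) :
    volume (cube c r) ^ e = ENNReal.ofReal ((2 * r) ^ (n * e)) := by
  rw [volume_cube c r hr, ENNReal.ofReal_rpow_of_pos (by positivity), ← Real.rpow_mul (by positivity)]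

/-- Translation and reflection of a cube. -/
lemma lintegral_cube_sub_left {n : ℕ} (F : En n → ℝ≥0∞) (x : En n) (r : ℝ) :
    ∫⁻ z in cube (0 : En n) r, F (x - z) = ∫⁻ y in cube x r, F y := by
  rw [← lintegral_indicator (measurableSet_cube _ _), ← lintegral_indicator (measurableSet_cube _ _),
    ← lintegral_sub_left_eq_self ((cube x r).indicator F) x]
  congr 1 with z
  have : z ∈ cube (0 : En n) r ↔ x - z ∈ cube x r := by
    simp [cube]
  by_cases h : z ∈ cube (0 : En n) r
  · rw [Set.indicator_of_mem h, Set.indicator_of_mem (this.1 h)]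
  · rw [Set.indicator_of_notMem h, Set.indicator_of_notMem (fun h' => h (this.2 h'))]

lemma lintegral_cube_sub_right {n : ℕ} (F : En n → ℝ≥0∞) (c z : En n) (r : ℝ) :
    ∫⁻ x in cube c r, F (x - z) = ∫⁻ y in cube (c - z) r, F y := by
  rw [← lintegral_indicator (measurableSet_cube _ _), ← lintegral_indicator (measurableSet_cube _ _),
    ← lintegral_sub_right_eq_self ((cube (c - z) r).indicator F) z]
  congr 1 with x
  have : x ∈ cube c r ↔ x - z ∈ cube (c - z) r := by
    simp [cube]
  by_cases h : x ∈ cube c r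
  · rw [Set.indicator_of_mem h, Set.indicator_of_mem (this.1 h)]
  · rw [Set.indicator_of_notMem h, Set.indicator_of_notMem (fun h' => h (this.2 h'))]

/-- Jensen / Hoelder. -/
lemma jensen {X : Type*} [MeasurableSpace X] (μ : Measure X) (F : X → ℝ≥0∞) (hF : Measurable F)
    {q : ℝ} (hq : 1 ≤ q) :
    ∫⁻ x, F x ∂μ ≤ (∫⁻ x, F x ^ q ∂μ) ^ (1 / q) * μ Set.univ ^ (1 - 1 / q) := by
  have := eLpNorm'_le_eLpNorm'_mul_rpow_measure_univ (μ := μ) (f := F) one_pos hq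
    hF.aestronglyMeasurable
  simpa [eLpNorm'] using this

/-- The shell with radii `ρ` and `2 ρ`. -/
def shell {n : ℕ} (ρ : ℝ) : Set (En n) := {z | ρ ≤ ‖z‖ ∧ ‖z‖ ≤ 2 * ρ}

lemma shell_subset {n : ℕ} (ρ : ℝ) (hρ : 0 < ρ) : shell ρ ⊆ cube (0 : En n) (3 * ρ) := by
  intro z hz i
  have := PiLp.norm_apply_le z i
  simp only [Real.norm_eq_abs] at this
  have h2 := hz.2
  have h3 : |z i| < 3 * ρ := by linarith
  simpa using h3

lemma measurableSet_shell {n : ℕ} (ρ : ℝ) : MeasurableSet (shell ρ : Set (En n)) :=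
  (measurableSet_le measurable_const measurable_norm).inter
    (measurableSet_le measurable_norm measurable_const)

lemma shell_sum {n : ℕ} (G : En n → ℝ≥0∞) (D e R w : ℝ) (hD : 0 ≤ D) (hR : 0 < R)
    (hw : 0 ≤ w) (hw1 : w < 1) (S : Set (En n)) (ρ : ℕ → ℝ) (hρ : ∀ j, 0 < ρ j)
    (hρe : ∀ j, ρ j ^ e ≤ R ^ e * w ^ j) (hS : S ⊆ ⋃ j, shell (ρ j))
    (hG : ∀ ρ : ℝ, 0 < ρ → ∫⁻ z in shell ρ, G z ≤ ENNReal.ofReal (D * ρ ^ e)) :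
    ∫⁻ z in S, G z ≤ ENNReal.ofReal ((1 - w)⁻¹ * D * R ^ e) := by
  calc ∫⁻ z in S, G z ≤ ∫⁻ z in ⋃ j, shell (ρ j), G z := lintegral_mono_set hS
    _ ≤ ∑' j, ∫⁻ z in shell (ρ j), G z := lintegral_iUnion_le _ _
    _ ≤ ∑' j, ENNReal.ofReal (D * R ^ e * w ^ j) := by
        refine ENNReal.tsum_le_tsum fun j => (hG _ (hρ j)).trans ?_
        refine ENNReal.ofReal_le_ofReal ?_
        rw [mul_assoc]
        exact mul_le_mul_of_nonneg_left (hρe j) hD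
    _ = ENNReal.ofReal ((1 - w)⁻¹ * D * R ^ e) := by
        rw [← ENNReal.ofReal_tsum_of_nonneg (fun j => by positivity)
          ((summable_geometric_of_lt_one hw hw1).mul_left _), tsum_mul_left,
          tsum_geometric_of_lt_one hw hw1]
        congr 1; ring

lemma far_sum {n : ℕ} (G : En n → ℝ≥0∞) (D e R : ℝ) (hD : 0 ≤ D) (hR : 0 < R) (he : e < 0)
    (hG : ∀ ρ : ℝ, 0 < ρ → ∫⁻ z in shell ρ, G z ≤ ENNReal.ofReal (D * ρ ^ e)) :
    ∫⁻ z in {z | R ≤ ‖z‖}, G z ≤ ENNReal.ofReal ((1 - (2 : ℝ) ^ e)⁻¹ * D * R ^ e) := by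
  refine shell_sum G D e R _ hD hR (by positivity) (Real.rpow_lt_one_of_one_lt_of_neg (by norm_num) he) _
    (fun j => R * 2 ^ j) (fun j => by positivity) (fun j => ?_) ?_ hG
  · rw [Real.mul_rpow hR.le (by positivity), ← Real.rpow_natCast, ← Real.rpow_natCast,
      ← Real.rpow_mul (by norm_num), ← Real.rpow_mul (by norm_num), mul_comm e]
  · intro z hz
    obtain ⟨j, hj1, hj2⟩ := exists_nat_pow_near (x := ‖z‖ / R) (y := 2)
      ((one_le_div hR).2 hz) (by norm_num)
    rw [le_div_iff₀ hR] at hj1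
    rw [div_lt_iff₀ hR] at hj2
    refine Set.mem_iUnion.2 ⟨j, by linarith, ?_⟩
    refine le_of_lt ?_
    calc ‖z‖ < _ := hj2
      _ = _ := by ring

lemma near_sum {n : ℕ} (G : En n → ℝ≥0∞) (D e R : ℝ) (hD : 0 ≤ D) (hR : 0 < R) (he : 0 < e)
    (hG : ∀ ρ : ℝ, 0 < ρ → ∫⁻ z in shell ρ, G z ≤ ENNReal.ofReal (D * ρ ^ e)) :
    ∫⁻ z in {z | 0 < ‖z‖ ∧ ‖z‖ < R}, G z ≤
      ENNReal.ofReal ((1 - (2⁻¹ : ℝ) ^ e)⁻¹ * D * R ^ e) := by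
  refine shell_sum G D e R _ hD hR (by positivity) (Real.rpow_lt_one (by norm_num) (by norm_num) he) _
    (fun j => R * 2⁻¹ ^ (j + 1)) (fun j => by positivity) (fun j => ?_) ?_ hG
  · rw [Real.mul_rpow hR.le (by positivity), ← Real.rpow_natCast, ← Real.rpow_natCast,
      ← Real.rpow_mul (by norm_num), ← Real.rpow_mul (by norm_num), mul_comm e]
    refine mul_le_mul_of_nonneg_left ?_ (by positivity)
    refine Real.rpow_le_rpow_of_exponent_ge (by norm_num) (by norm_num) ?_
    push_cast
    nlinarith
  · rintro z ⟨hz0, hz⟩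
    obtain ⟨j, hj1, hj2⟩ := exists_nat_pow_near_of_lt_one (x := ‖z‖ / R) (y := 2⁻¹)
      (by positivity) ((div_le_one hR).2 hz.le) (by norm_num) (by norm_num)
    rw [lt_div_iff₀ hR] at hj1
    rw [div_le_iff₀ hR] at hj2
    refine Set.mem_iUnion.2 ⟨j, by linarith, ?_⟩
    calc ‖z‖ ≤ _ := hj2
      _ = _ := by rw [pow_succ]; ring

end CommAux

namespace CommAux

/-- The Riesz kernel. -/
def rk {n : ℕ} (α : ℝ) (z : En n) : ℝ≥0∞ := ENNReal.ofReal (‖z‖ ^ (α - n))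

lemma measurable_rk {n : ℕ} (α : ℝ) : Measurable (rk α : En n → ℝ≥0∞) := by
  unfold rk
  fun_prop

lemma rk_shell {n : ℕ} (hn : 1 ≤ n) {α : ℝ} (hα1 : α < 1) {ρ : ℝ} (hρ : 0 < ρ) {z : En n}
    (hz : z ∈ shell ρ) : rk α z ≤ ENNReal.ofReal (ρ ^ (α - n)) := by
  have hn' : (1 : ℝ) ≤ n := by exact_mod_cast hn
  exact ENNReal.ofReal_le_ofReal (Real.rpow_le_rpow_of_nonpos hρ hz.1 (by linarith))

lemma rk_shell_int {n : ℕ} (hn : 1 ≤ n) {α : ℝ} (hα1 : α < 1) {ρ : ℝ} (hρ : 0 < ρ)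
    (H : En n → ℝ≥0∞) :
    ∫⁻ z in shell ρ, rk α z * H z ≤
      ENNReal.ofReal (ρ ^ (α - n)) * ∫⁻ z in cube (0 : En n) (3 * ρ), H z := by
  calc ∫⁻ z in shell ρ, rk α z * H z ≤ ∫⁻ z in shell ρ, ENNReal.ofReal (ρ ^ (α - n)) * H z := by
        refine setLIntegral_mono' (measurableSet_shell ρ) fun z hz => ?_
        gcongr
        exact rk_shell hn hα1 hρ hz
    _ = ENNReal.ofReal (ρ ^ (α - n)) * ∫⁻ z in shell ρ, H z :=
        lintegral_const_mul' _ _ ENNReal.ofReal_ne_top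
    _ ≤ _ := by
        gcongr
        exact shell_subset ρ hρ

lemma near_mass {n : ℕ} (hn : 1 ≤ n) {α : ℝ} (hα : 0 < α) (hα1 : α < 1) {R : ℝ} (hR : 0 < R) :
    ∫⁻ z in {z : En n | 0 < ‖z‖ ∧ ‖z‖ < R}, rk α z ≤
      ENNReal.ofReal ((1 - (2⁻¹ : ℝ) ^ α)⁻¹ * 6 ^ (n : ℝ) * R ^ α) := by
  refine near_sum _ _ _ _ (by positivity) hR hα fun ρ hρ => ?_
  have := rk_shell_int hn hα1 hρ (fun _ : En n => 1)
  simp only [mul_one, lintegral_const, Measure.restrict_apply, MeasurableSet.univ,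
    Set.univ_inter, one_mul] at this
  refine this.trans ?_
  rw [volume_cube _ _ (by positivity), ← ENNReal.ofReal_mul (by positivity)]
  refine ENNReal.ofReal_le_ofReal (le_of_eq ?_)
  rw [← mul_assoc, Real.mul_rpow (by norm_num) hρ.le, Real.rpow_sub hρ]
  have : ρ ^ (n : ℝ) ≠ 0 := by positivity
  field_simp
  norm_num

/-- Morrey-type control of a nonnegative function. -/
def Mor {n : ℕ} (p q N : ℝ) (F : En n → ℝ≥0∞) : Prop :=
  ∀ (c : En n) (r : ℝ), 0 < r → (∫⁻ y in cube c r, F y ^ q) ^ (1 / q) ≤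
    ENNReal.ofReal (N * (2 * r) ^ (n * (1 / q - 1 / p)))

lemma Mor.l1 {n : ℕ} {p q N : ℝ} {F : En n → ℝ≥0∞} (hF : Measurable F) (h : Mor p q N F)
    (hN : 0 ≤ N) (hq : 1 ≤ q) (c : En n) (r : ℝ) (hr : 0 < r) :
    ∫⁻ y in cube c r, F y ≤ ENNReal.ofReal (N * (2 * r) ^ (n * (1 - 1 / p))) := by
  refine (jensen _ F hF hq).trans ?_
  rw [Measure.restrict_apply_univ, volume_cube_rpow _ _ hr]
  refine (mul_le_mul_left (h c r hr) _).trans ?_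
  rw [← ENNReal.ofReal_mul (by positivity)]
  refine ENNReal.ofReal_le_ofReal (le_of_eq ?_)
  rw [mul_assoc, ← Real.rpow_add (by positivity)]
  congr 2; ring

lemma Mor.far {n : ℕ} (hn : 1 ≤ n) {α p q N : ℝ} (hα1 : α < 1) {F : En n → ℝ≥0∞}
    (hF : Measurable F) (h : Mor p q N F)
    (hN : 0 ≤ N) (hq : 1 ≤ q) (he : α - n / p < 0) {R : ℝ} (hR : 0 < R) (x : En n) :
    ∫⁻ z in {z : En n | R ≤ ‖z‖}, rk α z * F (x - z) ≤
      ENNReal.ofReal ((1 - (2 : ℝ) ^ (α - n / p))⁻¹ * (N * 6 ^ (n * (1 - 1 / p)))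
        * R ^ (α - n / p)) := by
  refine far_sum _ _ _ _ (by positivity) hR he fun ρ hρ => ?_
  refine (rk_shell_int hn hα1 hρ (fun z => F (x - z))).trans ?_
  rw [lintegral_cube_sub_left]
  refine (mul_le_mul_right (h.l1 hF hN hq x (3 * ρ) (by positivity)) _).trans ?_
  rw [← ENNReal.ofReal_mul (by positivity)]
  refine ENNReal.ofReal_le_ofReal (le_of_eq ?_)
  rw [← mul_assoc 2 3 ρ, Real.mul_rpow (by norm_num) hρ.le]
  have : ρ ^ (α - n / p) = ρ ^ (α - n) * ρ ^ (n * (1 - 1 / p)) := by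
    rw [← Real.rpow_add hρ]; congr 1; ring
  rw [this]
  norm_num
  ring

/-- near part -/
def nearI {n : ℕ} (α R : ℝ) (F : En n → ℝ≥0∞) (x : En n) : ℝ≥0∞ :=
  ∫⁻ z in {z : En n | 0 < ‖z‖ ∧ ‖z‖ < R}, rk α z * F (x - z)

lemma measurable_nearI {n : ℕ} (α R : ℝ) {F : En n → ℝ≥0∞} (hF : Measurable F) :
    Measurable (nearI α R F) := by
  unfold nearI
  refine Measurable.lintegral_prod_right' (f := fun w : En n × En n => rk α w.2 * F (w.1 - w.2)) ?_
  exact ((measurable_rk α).comp measurable_snd).mul (hF.comp (measurable_fst.sub measurable_snd))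

lemma nearI_rpow {n : ℕ} (α R : ℝ) {F : En n → ℝ≥0∞} (hF : Measurable F) {q : ℝ} (hq : 1 ≤ q)
    (x : En n) : nearI α R F x ^ q ≤
      (∫⁻ z in {z : En n | 0 < ‖z‖ ∧ ‖z‖ < R}, rk α z) ^ (q - 1) *
      ∫⁻ z in {z : En n | 0 < ‖z‖ ∧ ‖z‖ < R}, rk α z * F (x - z) ^ q := by
  set S := {z : En n | 0 < ‖z‖ ∧ ‖z‖ < R}
  have hFx : Measurable fun z => F (x - z) := hF.comp (measurable_const.sub measurable_id)
  have h := jensen ((volume.restrict S).withDensity (rk α)) (fun z => F (x - z)) hFx hq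
  rw [lintegral_withDensity_eq_lintegral_mul _ (measurable_rk α) hFx,
    lintegral_withDensity_eq_lintegral_mul _ (measurable_rk α) (hFx.pow_const q),
    withDensity_apply _ MeasurableSet.univ, Measure.restrict_univ] at h
  have hq0 : (0 : ℝ) < q := by linarith
  have h2 := ENNReal.rpow_le_rpow h hq0.le
  rw [ENNReal.mul_rpow_of_nonneg _ _ hq0.le, ← ENNReal.rpow_mul, ← ENNReal.rpow_mul,
    one_div_mul_cancel hq0.ne', ENNReal.rpow_one, sub_mul, one_div_mul_cancel hq0.ne', one_mul] at h2
  rw [mul_comm]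
  exact h2

lemma Mor.near {n : ℕ} (hn : 1 ≤ n) {α p q N : ℝ} (hα : 0 < α) (hα1 : α < 1) {F : En n → ℝ≥0∞}
    (hF : Measurable F) (h : Mor p q N F)
    (hN : 0 ≤ N) (hq : 1 ≤ q) {R : ℝ} (hR : 0 < R) (c : En n) (r : ℝ) (hr : 0 < r) :
    (∫⁻ x in cube c r, nearI α R F x ^ q) ^ (1 / q) ≤
      ENNReal.ofReal ((1 - (2⁻¹ : ℝ) ^ α)⁻¹ * 6 ^ (n : ℝ) * R ^ α *
        (N * (2 * r) ^ (n * (1 / q - 1 / p)))) := by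
  have hq0 : (0 : ℝ) < q := by linarith
  have hC : 0 ≤ (1 - (2⁻¹ : ℝ) ^ α)⁻¹ := inv_nonneg.2 (sub_nonneg.2
    (Real.rpow_lt_one (by norm_num) (by norm_num) hα).le)
  set κ := ∫⁻ z in {z : En n | 0 < ‖z‖ ∧ ‖z‖ < R}, rk α z with hκ
  set M := ENNReal.ofReal (N * (2 * r) ^ (n * (1 / q - 1 / p))) with hM
  have hκtop : κ ≠ ⊤ := ne_top_of_le_ne_top ENNReal.ofReal_ne_top (near_mass hn hα hα1 hR)
  have key : ∫⁻ x in cube c r, nearI α R F x ^ q ≤ κ ^ q * M ^ q := by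
    calc ∫⁻ x in cube c r, nearI α R F x ^ q
        ≤ ∫⁻ x in cube c r, κ ^ (q - 1) *
          ∫⁻ z in {z : En n | 0 < ‖z‖ ∧ ‖z‖ < R}, rk α z * F (x - z) ^ q :=
          lintegral_mono fun x => nearI_rpow α R hF hq x
      _ = κ ^ (q - 1) * ∫⁻ x in cube c r,
          ∫⁻ z in {z : En n | 0 < ‖z‖ ∧ ‖z‖ < R}, rk α z * F (x - z) ^ q :=
          lintegral_const_mul' _ _ (ENNReal.rpow_ne_top_of_nonneg (by linarith) hκtop)
      _ = κ ^ (q - 1) * ∫⁻ z in {z : En n | 0 < ‖z‖ ∧ ‖z‖ < R}, ∫⁻ x in cube c r,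
          rk α z * F (x - z) ^ q := by
          congr 1
          refine lintegral_lintegral_swap (Measurable.aemeasurable ?_)
          exact ((measurable_rk α).comp measurable_snd).mul
            ((hF.comp (measurable_fst.sub measurable_snd)).pow_const q)
      _ ≤ κ ^ (q - 1) * ∫⁻ z in {z : En n | 0 < ‖z‖ ∧ ‖z‖ < R}, rk α z * M ^ q := by
          gcongr with z
          rw [lintegral_const_mul' (rk α z) _ ENNReal.ofReal_ne_top,
            lintegral_cube_sub_right (fun y => F y ^ q)]
          gcongr
          have := ENNReal.rpow_le_rpow (h (c - z) r hr) hq0.le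
          rwa [← ENNReal.rpow_mul, one_div_mul_cancel hq0.ne', ENNReal.rpow_one] at this
      _ = κ ^ q * M ^ q := by
          rw [lintegral_mul_const' _ _ (ENNReal.rpow_ne_top_of_nonneg hq0.le ENNReal.ofReal_ne_top),
            ← hκ, ← mul_assoc]
          congr 1
          nth_rw 2 [← ENNReal.rpow_one κ]
          rw [← ENNReal.rpow_add_of_nonneg _ _ (by linarith) (by norm_num)]
          congr 1; ring
  calc (∫⁻ x in cube c r, nearI α R F x ^ q) ^ (1 / q) ≤ (κ ^ q * M ^ q) ^ (1 / q) :=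
        ENNReal.rpow_le_rpow key (by positivity)
    _ = κ * M := by
        rw [← ENNReal.mul_rpow_of_nonneg _ _ hq0.le, ← ENNReal.rpow_mul,
          mul_one_div_cancel hq0.ne', ENNReal.rpow_one]
    _ ≤ ENNReal.ofReal ((1 - (2⁻¹ : ℝ) ^ α)⁻¹ * 6 ^ (n : ℝ) * R ^ α) * M := by
        gcongr
        exact near_mass hn hα hα1 hR
    _ = _ := by
        rw [hM, ← ENNReal.ofReal_mul (by positivity)]

/-- Riesz potential -/
def riesz {n : ℕ} (α : ℝ) (F : En n → ℝ≥0∞) (x : En n) : ℝ≥0∞ := ∫⁻ y, rk α (x - y) * F y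

lemma riesz_le {n : ℕ} (hn : 1 ≤ n) {α : ℝ} (hα1 : α < 1) (F : En n → ℝ≥0∞) (x : En n) (R : ℝ) :
    riesz α F x ≤ nearI α R F x + ∫⁻ z in {z : En n | R ≤ ‖z‖}, rk α z * F (x - z) := by
  have hn' : (1 : ℝ) ≤ n := by exact_mod_cast hn
  have h1 : riesz α F x = ∫⁻ z, rk α z * F (x - z) := by
    unfold riesz
    rw [← lintegral_sub_left_eq_self (fun y => rk α (x - y) * F y) x]
    simp
  have h2 : ∫⁻ z in {z : En n | ‖z‖ = 0}, rk α z * F (x - z) = 0 := by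
    have hm : MeasurableSet {z : En n | ‖z‖ = 0} :=
      measurableSet_eq_fun measurable_norm measurable_const
    rw [setLIntegral_congr_fun hm (g := fun _ => 0)]
    · simp
    · intro z hz
      have hz' : ‖z‖ = 0 := hz
      simp only [rk, hz', Real.zero_rpow (by linarith : α - n ≠ 0), ENNReal.ofReal_zero, zero_mul]
  have hU : (Set.univ : Set (En n)) ⊆ ({z : En n | 0 < ‖z‖ ∧ ‖z‖ < R} ∪ {z : En n | R ≤ ‖z‖}) ∪
      {z : En n | ‖z‖ = 0} := by
    intro z _
    rcases (norm_nonneg z).eq_or_lt with h | h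
    · exact Or.inr h.symm
    · rcases lt_or_ge ‖z‖ R with h' | h'
      · exact Or.inl (Or.inl ⟨h, h'⟩)
      · exact Or.inl (Or.inr h')
  rw [h1, ← setLIntegral_univ]
  refine (lintegral_mono_set hU).trans ((lintegral_union_le _ _ _).trans ?_)
  rw [h2, add_zero]
  exact lintegral_union_le _ _ _

lemma riesz_ae_lt_top {n : ℕ} (hn : 1 ≤ n) {α p q N : ℝ} (hα : 0 < α) (hα1 : α < 1)
    {F : En n → ℝ≥0∞} (hF : Measurable F) (h : Mor p q N F)
    (hN : 0 ≤ N) (hq : 1 ≤ q) (he : α - n / p < 0) :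
    ∀ᵐ x : En n, riesz α F x < ⊤ := by
  have hq0 : (0 : ℝ) < q := by linarith
  have h1 : ∀ k : ℕ, ∀ᵐ x : En n, x ∈ cube (0 : En n) (k + 1) → nearI α 1 F x < ⊤ := by
    intro k
    rw [← ae_restrict_iff' (measurableSet_cube _ _)]
    have hh : ∫⁻ x in cube (0 : En n) (k + 1), nearI α 1 F x ^ q ≠ ⊤ := by
      have := ne_top_of_le_ne_top ENNReal.ofReal_ne_top
        (h.near hn hα hα1 hF hN hq one_pos (0 : En n) (k + 1) (by positivity))
      intro h'
      rw [h', ENNReal.top_rpow_of_pos (by positivity)] at this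
      exact this rfl
    filter_upwards [ae_lt_top ((measurable_nearI α 1 hF).pow_const q) hh] with x hx
    by_contra h'
    rw [not_lt, top_le_iff] at h'
    rw [h', ENNReal.top_rpow_of_pos hq0] at hx
    exact lt_irrefl _ hx
  filter_upwards [ae_all_iff.2 h1] with x hx
  obtain ⟨k, hk⟩ := exists_nat_gt ‖x‖
  have hxk := hx k (by
    intro i
    have := PiLp.norm_apply_le x i
    simp only [Real.norm_eq_abs] at this
    have h3 : |x i| < k + 1 := by linarith
    simpa using h3)
  refine (riesz_le hn hα1 F x 1).trans_lt (ENNReal.add_lt_top.2 ⟨hxk, ?_⟩)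
  exact (h.far hn hα1 hF hN hq he one_pos x).trans_lt ENNReal.ofReal_lt_top

end CommAux

namespace CommAux

lemma real_aux {p q s t μ V X c : ℝ} (hp : 0 < p) (hq : 0 < q) (hs : 0 < s) (ht : 0 < t)
    (htA : p / (q * s) ≤ 1 / t)
    (hμ : 0 ≤ μ) (hμV : μ ≤ V) (hV : 0 < V) (hX : 0 < X) (hc : 0 < c)
    (h : μ ^ (1 / q) ≤ c * X ^ (s / p) * V ^ (1 / q - 1 / p)) :
    V ^ (1 / s - 1 / t) * μ ^ (1 / t) ≤ c ^ (p / s) * X := by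
  rcases hμ.eq_or_lt with h0 | hμ0
  · rw [← h0, Real.zero_rpow (by positivity), mul_zero]; positivity
  have h1 : μ ^ (p / (q * s)) ≤ c ^ (p / s) * X * V ^ (p / (q * s) - 1 / s) := by
    have h2 := Real.rpow_le_rpow (by positivity) h (by positivity : 0 ≤ p / s)
    rw [Real.mul_rpow (by positivity) (by positivity), Real.mul_rpow (by positivity) (by positivity),
      ← Real.rpow_mul hμ, ← Real.rpow_mul hX.le, ← Real.rpow_mul hV.le] at h2
    have e1 : 1 / q * (p / s) = p / (q * s) := by field_simp
    have e2 : s / p * (p / s) = 1 := by field_simp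
    have e3 : (1 / q - 1 / p) * (p / s) = p / (q * s) - 1 / s := by field_simp
    rwa [e1, e2, e3, Real.rpow_one] at h2
  have h3 : μ ^ (1 / t - p / (q * s)) ≤ V ^ (1 / t - p / (q * s)) :=
    Real.rpow_le_rpow hμ hμV (by linarith)
  calc V ^ (1 / s - 1 / t) * μ ^ (1 / t)
      = V ^ (1 / s - 1 / t) * (μ ^ (p / (q * s)) * μ ^ (1 / t - p / (q * s))) := by
        rw [← Real.rpow_add hμ0]; congr 2; ring
    _ ≤ V ^ (1 / s - 1 / t) * ((c ^ (p / s) * X * V ^ (p / (q * s) - 1 / s)) *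
          V ^ (1 / t - p / (q * s))) := by gcongr
    _ = c ^ (p / s) * X * (V ^ (1 / s - 1 / t) * V ^ (p / (q * s) - 1 / s) *
          V ^ (1 / t - p / (q * s))) := by ring
    _ = c ^ (p / s) * X := by
        rw [← Real.rpow_add hV, ← Real.rpow_add hV]
        have : 1 / s - 1 / t + (p / (q * s) - 1 / s) + (1 / t - p / (q * s)) = 0 := by ring
        rw [this, Real.rpow_zero, mul_one]

/-- Constants. -/
def c1 (n : ℕ) (α : ℝ) : ℝ := (1 - (2⁻¹ : ℝ) ^ α)⁻¹ * 6 ^ (n : ℝ)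
def c2 (n : ℕ) (α p : ℝ) : ℝ := (1 - (2 : ℝ) ^ (α - n / p))⁻¹ * 6 ^ (n * (1 - 1 / p))

lemma c1_pos (n : ℕ) {α : ℝ} (hα : 0 < α) : 0 < c1 n α :=
  mul_pos (inv_pos.2 (sub_pos.2 (Real.rpow_lt_one (by norm_num) (by norm_num) hα))) (by positivity)

lemma c2_pos (n : ℕ) {α p : ℝ} (he : α - n / p < 0) : 0 < c2 n α p :=
  mul_pos (inv_pos.2 (sub_pos.2 (Real.rpow_lt_one_of_one_lt_of_neg (by norm_num) he)))
    (by positivity)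

def cc (n : ℕ) (α p s : ℝ) : ℝ := (c1 n α * c2 n α p ^ (s / p - 1)) ^ (p / s) * 2

lemma weak_bound {n : ℕ} (hn : 1 ≤ n) {α p q s t N B : ℝ} (hα : 0 < α) (hα1 : α < 1)
    {F : En n → ℝ≥0∞} (hF : Measurable F) (h : Mor p q N F)
    (hN : 0 < N) (hB : 0 < B) (hq : 1 ≤ q) (hqp : q ≤ p) (ht : 1 < t) (hts : t ≤ s)
    (hs : 1 / s = 1 / p - α / n) (htq : 1 / t = 1 / q - α / n)
    (g : En n → ℂ) (hg : ∀ x, ‖g x‖ₑ ≤ ENNReal.ofReal B * riesz α F x) :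
    weakMorreyNorm s t g ≤ ENNReal.ofReal (cc n α p s * (B * N)) := by
  have hn0 : (0 : ℝ) < n := by exact_mod_cast hn
  have hq0 : 0 < q := by linarith
  have hp0 : 0 < p := by linarith
  have ht0 : 0 < t := by linarith
  have hs0 : 0 < s := by linarith
  have hee : α - n / p = -(n / s) := by
    have : n / s = n * (1 / s) := by ring
    rw [this, hs]; field_simp; ring
  have he : α - n / p < 0 := by rw [hee]; exact neg_lt_zero.2 (by positivity)
  have hC1 := c1_pos n hα
  have hC2 := c2_pos n he
  have hsα : s / n * α = s / p - 1 := by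
    have : α / n = 1 / p - 1 / s := by linarith
    have h2 : s / n * α = s * (α / n) := by ring
    rw [h2, this]; field_simp
  have htA : p / (q * s) ≤ 1 / t := by
    have h1 : p / (q * s) = p / q * (1 / s) := by field_simp
    rw [h1, hs, htq]
    have h2 : p / q * (1 / p - α / n) = 1 / q - p / q * (α / n) := by field_simp
    rw [h2]
    have h3 : 1 ≤ p / q := (one_le_div hq0).2 hqp
    have : 0 < α / n := by positivity
    nlinarith
  refine iSup_le fun c => iSup_le fun r => iSup_le fun hr => ?_
  rw [ENNReal.mul_iSup]
  refine iSup_le fun l => ?_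
  rw [ENNReal.mul_iSup]
  refine iSup_le fun hl => ?_
  set E := {y ∈ cube c r | l < ‖g y‖} with hE
  set X : ℝ := 2 * B * N / l with hX
  have hX0 : 0 < X := by positivity
  set R : ℝ := (c2 n α p * X) ^ (s / n) with hRdef
  have hR : 0 < R := by positivity
  have hfar : B * (c2 n α p * N * R ^ (α - n / p)) = l / 2 := by
    rw [hee, hRdef, ← Real.rpow_mul (by positivity)]
    have : s / n * -(n / s) = -1 := by field_simp
    rw [this, Real.rpow_neg_one, hX]
    field_simp
  have hsub : ∀ x ∈ E, ENNReal.ofReal (l / (2 * B)) ≤ nearI α R F x := by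
    intro x hx
    have h1 : ENNReal.ofReal l ≤ ENNReal.ofReal B * nearI α R F x + ENNReal.ofReal (l / 2) := by
      calc ENNReal.ofReal l ≤ ‖g x‖ₑ := by
            rw [← ofReal_norm_eq_enorm]; exact ENNReal.ofReal_le_ofReal hx.2.le
        _ ≤ _ := hg x
        _ ≤ ENNReal.ofReal B * (nearI α R F x +
            ENNReal.ofReal (c2 n α p * N * R ^ (α - n / p))) := by
            gcongr
            refine (riesz_le hn hα1 F x R).trans ?_
            gcongr
            refine (h.far hn hα1 hF hN.le hq he hR x).trans (le_of_eq ?_)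
            congr 1
            unfold c2; ring
        _ = _ := by
            rw [mul_add, ← ENNReal.ofReal_mul hB.le, hfar]
    have h2 : ENNReal.ofReal (l / 2) ≤ ENNReal.ofReal B * nearI α R F x := by
      have : ENNReal.ofReal l = ENNReal.ofReal (l / 2) + ENNReal.ofReal (l / 2) := by
        rw [← ENNReal.ofReal_add (by positivity) (by positivity)]; congr 1; ring
      rw [this] at h1
      exact (ENNReal.add_le_add_iff_right ENNReal.ofReal_ne_top).1 h1
    have h3 : l / (2 * B) = l / 2 / B := by field_simp
    rw [h3, ENNReal.ofReal_div_of_pos hB]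
    exact ENNReal.div_le_of_le_mul' h2
  have hm1 : ENNReal.ofReal (l / (2 * B)) ^ q * volume E ≤ ∫⁻ x in cube c r, nearI α R F x ^ q := by
    refine le_trans ?_ (mul_meas_ge_le_lintegral₀
      ((measurable_nearI α R hF).pow_const q).aemeasurable (ENNReal.ofReal (l / (2 * B)) ^ q))
    refine mul_le_mul_right ?_ _
    rw [Measure.restrict_apply
      (measurableSet_le measurable_const ((measurable_nearI α R hF).pow_const q))]
    refine measure_mono fun x hx => ⟨?_, hx.1⟩
    exact ENNReal.rpow_le_rpow (hsub x hx) hq0.le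
  have hEle : volume E ≤ ENNReal.ofReal ((2 * r) ^ (n : ℝ)) := by
    rw [← volume_cube c r hr]
    exact measure_mono fun x hx => hx.1
  have hEtop : volume E ≠ ⊤ := ne_top_of_le_ne_top ENNReal.ofReal_ne_top hEle
  obtain ⟨μ, hμ0, hμ⟩ : ∃ μ : ℝ, 0 ≤ μ ∧ volume E = ENNReal.ofReal μ :=
    ⟨(volume E).toReal, ENNReal.toReal_nonneg, (ENNReal.ofReal_toReal hEtop).symm⟩
  rw [hμ] at hm1 hEle ⊢
  set V : ℝ := (2 * r) ^ (n : ℝ) with hV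
  have hV0 : 0 < V := by positivity
  have hVpow : ∀ e : ℝ, (2 * r) ^ (n * e) = V ^ e := fun e => by
    rw [hV, ← Real.rpow_mul (by positivity)]
  have hμV : μ ≤ V := (ENNReal.ofReal_le_ofReal_iff hV0.le).1 hEle
  have hm2 : l / (2 * B) * μ ^ (1 / q) ≤ c1 n α * R ^ α * (N * V ^ (1 / q - 1 / p)) := by
    have h1 := (ENNReal.rpow_le_rpow hm1 (by positivity : 0 ≤ 1 / q)).trans
      (h.near hn hα hα1 hF hN.le hq hR c r hr)
    rw [ENNReal.mul_rpow_of_nonneg _ _ (by positivity), ← ENNReal.rpow_mul,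
      mul_one_div_cancel hq0.ne', ENNReal.rpow_one,
      ENNReal.ofReal_rpow_of_nonneg hμ0 (by positivity), ← ENNReal.ofReal_mul (by positivity),
      hVpow] at h1
    exact (ENNReal.ofReal_le_ofReal_iff (by positivity)).1 h1
  have hRα : R ^ α = c2 n α p ^ (s / p - 1) * X ^ (s / p - 1) := by
    rw [hRdef, ← Real.rpow_mul (by positivity), hsα, Real.mul_rpow hC2.le hX0.le]
  have hm3 : μ ^ (1 / q) ≤ c1 n α * c2 n α p ^ (s / p - 1) * X ^ (s / p) * V ^ (1 / q - 1 / p) := by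
    have : X ^ (s / p) = X ^ (s / p - 1) * X := by
      rw [Real.rpow_sub_one hX0.ne']; field_simp
    rw [this]
    calc μ ^ (1 / q) = (2 * B / l) * (l / (2 * B) * μ ^ (1 / q)) := by field_simp
      _ ≤ (2 * B / l) * (c1 n α * R ^ α * (N * V ^ (1 / q - 1 / p))) := by gcongr
      _ = _ := by rw [hRα, hX]; ring
  have hfin := real_aux hp0 hq0 hs0 ht0 htA hμ0 hμV hV0 hX0 (by positivity) hm3
  rw [volume_cube_rpow _ _ hr, hVpow, ENNReal.mul_rpow_of_nonneg _ _ (by positivity),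
    ← ENNReal.rpow_mul, mul_one_div_cancel ht0.ne', ENNReal.rpow_one,
    ENNReal.ofReal_rpow_of_nonneg hμ0 (by positivity), ← ENNReal.ofReal_mul (by positivity),
    ← ENNReal.ofReal_mul (by positivity)]
  refine ENNReal.ofReal_le_ofReal ?_
  calc V ^ (1 / s - 1 / t) * (l * μ ^ (1 / t)) = l * (V ^ (1 / s - 1 / t) * μ ^ (1 / t)) := by ring
    _ ≤ l * ((c1 n α * c2 n α p ^ (s / p - 1)) ^ (p / s) * X) := by gcongr
    _ = _ := by rw [hX, cc]; field_simp

lemma mor_of_morrey {n : ℕ} {p q N : ℝ} (f : En n → ℂ) (hN : morreyNorm p q f ≤ ENNReal.ofReal N)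
    (hN0 : 0 ≤ N) :
    Mor p q N (fun x => ‖f x‖ₑ) := by
  intro c r hr
  have h1 : volume (cube c r) ^ (1 / p - 1 / q) *
      (∫⁻ y in cube c r, (‖f y‖₊ : ℝ≥0∞) ^ q) ^ (1 / q) ≤ ENNReal.ofReal N := by
    refine le_trans ?_ hN
    unfold morreyNorm
    exact le_iSup_of_le c (le_iSup_of_le r (le_iSup_of_le hr le_rfl))
  rw [volume_cube_rpow _ _ hr] at h1
  have h2 := mul_le_mul_right h1 (ENNReal.ofReal ((2 * r) ^ (n * (1 / q - 1 / p))))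
  rw [← mul_assoc, ← ENNReal.ofReal_mul (by positivity), ← Real.rpow_add (by positivity)] at h2
  have : (n : ℝ) * (1 / q - 1 / p) + n * (1 / p - 1 / q) = 0 := by ring
  rw [this, Real.rpow_zero, ENNReal.ofReal_one, one_mul, ← ENNReal.ofReal_mul (by positivity),
    mul_comm _ N] at h2
  exact h2

lemma lip_le {n : ℕ} {α : ℝ} (hα : 0 < α) (b : En n → ℝ) (x y : En n) :
    ‖b x - b y‖ₑ ≤ lipSeminorm α b * edist x y ^ α := by
  by_cases hxy : x = y
  · simp [hxy]
  · have h1 : ‖b x - b y‖ₑ / edist x y ^ α ≤ lipSeminorm α b := by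
      unfold lipSeminorm
      exact le_iSup_of_le x (le_iSup_of_le y (le_iSup_of_le hxy le_rfl))
    rwa [ENNReal.div_le_iff] at h1
    · have := edist_pos.2 hxy
      exact (ENNReal.rpow_pos this (edist_ne_top _ _)).ne'
    · exact ENNReal.rpow_ne_top_of_nonneg hα.le (edist_ne_top _ _)

lemma lip_cont {n : ℕ} {α : ℝ} (hα : 0 < α) (b : En n → ℝ) (hb : lipSeminorm α b < ⊤) :
    Continuous b := by
  have : HolderWith (lipSeminorm α b).toNNReal ⟨α, hα.le⟩ b := by
    intro x y
    rw [ENNReal.coe_toNNReal hb.ne, edist_eq_enorm_sub]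
    exact lip_le hα b x y
  exact this.continuous (by exact_mod_cast hα)

lemma kernel_le {n : ℕ} {α A : ℝ} (hα : 0 < α) (hA : 0 ≤ A) (K : En n → ℂ)
    (hK : ∀ z : En n, z ≠ 0 → ‖K z‖ ≤ A * ‖z‖ ^ (-(n : ℝ))) (b : En n → ℝ) (f : En n → ℂ)
    (x y : En n) :
    ‖((b x - b y : ℝ) : ℂ) * K (x - y) * f y‖ₑ ≤
      ENNReal.ofReal A * lipSeminorm α b * (rk α (x - y) * ‖f y‖ₑ) := by
  by_cases hxy : x = y
  · simp [hxy]
  · have hz : x - y ≠ 0 := sub_ne_zero.2 hxy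
    have hz' : 0 < ‖x - y‖ := norm_pos_iff.2 hz
    have h1 : ‖K (x - y)‖ₑ ≤ ENNReal.ofReal A * ENNReal.ofReal (‖x - y‖ ^ (-(n : ℝ))) := by
      rw [← ENNReal.ofReal_mul hA, ← ofReal_norm_eq_enorm]
      exact ENNReal.ofReal_le_ofReal (hK _ hz)
    have h2 : ‖((b x - b y : ℝ) : ℂ)‖ₑ ≤ lipSeminorm α b * ENNReal.ofReal (‖x - y‖ ^ α) := by
      have := lip_le hα b x y
      rw [edist_dist, dist_eq_norm, ENNReal.ofReal_rpow_of_pos hz'] at this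
      rwa [← ofReal_norm_eq_enorm, Complex.norm_real, ofReal_norm_eq_enorm]
    have h3 : rk α (x - y) = ENNReal.ofReal (‖x - y‖ ^ α) * ENNReal.ofReal (‖x - y‖ ^ (-(n : ℝ))) := by
      rw [← ENNReal.ofReal_mul (by positivity), ← Real.rpow_add hz']; rfl
    rw [enorm_mul, enorm_mul, h3]
    refine (mul_le_mul_left (mul_le_mul' h2 h1) _).trans (le_of_eq ?_)
    ring

lemma zero_dim {α p q s t : ℝ} (ht : 1 < t) (A : ℝ) (K : En 0 → ℂ) (b : En 0 → ℝ) (f : En 0 → ℂ) :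
    (∀ᵐ x : En 0, Integrable (fun y => ((b x - b y : ℝ) : ℂ) * K (x - y) * f y)) ∧
          weakMorreyNorm s t (fun x => ∫ y, ((b x - b y : ℝ) : ℂ) * K (x - y) * f y) ≤
            ENNReal.ofReal 1 * ENNReal.ofReal A * lipSeminorm α b * morreyNorm p q f := by
  have h0 : ∀ x y : En 0, ((b x - b y : ℝ) : ℂ) * K (x - y) * f y = 0 := by
    intro x y
    rw [Subsingleton.elim x y]; simp
  simp only [h0]
  refine ⟨by simp, ?_⟩
  have : weakMorreyNorm s t (fun x : En 0 => ∫ y : En 0, (0 : ℂ)) = 0 := by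
    unfold weakMorreyNorm
    simp only [integral_zero, norm_zero, ENNReal.iSup_eq_zero]
    intro c r hr
    have h1 : ∀ l : ℝ, 0 < l → {y ∈ cube c r | l < 0} = ∅ := by
      intro l hl; ext y; simp [hl.le]
    have h2 : (⨆ (l : ℝ) (_ : 0 < l),
        (ENNReal.ofReal l ^ t * volume {y ∈ cube c r | l < 0}) ^ (1 / t)) = 0 := by
      simp only [ENNReal.iSup_eq_zero]
      intro l hl
      rw [h1 l hl, measure_empty, mul_zero, ENNReal.zero_rpow_of_pos (by positivity)]
    rw [h2, mul_zero]
  rw [this]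
  exact zero_le

end CommAux


/-- For `0 < α < 1`, `1 ≤ q ≤ p < ∞`, `1 < t ≤ s < ∞` with `1/s = 1/p - α/n`
and `1/t = 1/q - α/n`, a kernel with `|K z| ≤ A |z|^{-n}` and `b ∈ Lip_α`, the commutator
`C_b f(x) = ∫ (b x - b y) K(x-y) f(y) dy` (absolutely convergent a.e.) satisfies
`‖C_b f‖_{WM^s_t} ≤ C A ‖b‖_{Lip_α} ‖f‖_{M^p_q}`, with `C` depending only on `n, α, p, q`. -/
theorem commutator_weak_Morrey_bound_of_lip (n : ℕ) (α p q s t : ℝ)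
    (hα : 0 < α) (hα1 : α < 1) (hq : 1 ≤ q) (hqp : q ≤ p) (ht : 1 < t) (hts : t ≤ s)
    (hs : 1 / s = 1 / p - α / n) (htq : 1 / t = 1 / q - α / n) :
    ∃ C : ℝ, 0 < C ∧
      ∀ (A : ℝ) (K : En n → ℂ), Measurable K →
        (∀ z : En n, z ≠ 0 → ‖K z‖ ≤ A * ‖z‖ ^ (-(n : ℝ))) →
        ∀ b : En n → ℝ, lipSeminorm α b < ⊤ →
        ∀ f : En n → ℂ, Measurable f → morreyNorm p q f < ⊤ →
          (∀ᵐ x : En n, Integrable (fun y => ((b x - b y : ℝ) : ℂ) * K (x - y) * f y)) ∧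
          weakMorreyNorm s t (fun x => ∫ y, ((b x - b y : ℝ) : ℂ) * K (x - y) * f y) ≤
            ENNReal.ofReal C * ENNReal.ofReal A * lipSeminorm α b * morreyNorm p q f := by
  rcases Nat.eq_zero_or_pos n with rfl | hn
  · exact ⟨1, one_pos, fun A K _ _ b _ f _ _ => CommAux.zero_dim ht A K b f⟩
  have hn0 : (0 : ℝ) < n := by exact_mod_cast hn
  have hs0 : 0 < s := by linarith
  have hp0 : 0 < p := by linarith
  have he : α - n / p < 0 := by
    have h1 : α - n / p = -(n * (1 / s)) := by
      rw [hs]; field_simp; ring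
    rw [h1]; exact neg_lt_zero.2 (by positivity)
  have hcc : 0 < CommAux.cc n α p s := by
    have h1 := CommAux.c1_pos n hα
    have h2 := CommAux.c2_pos n he
    unfold CommAux.cc
    positivity
  refine ⟨CommAux.cc n α p s, hcc, fun A K hKm hK b hb f hf hfM => ?_⟩
  have hA : 0 ≤ A := by
    have : NeZero n := ⟨hn.ne'⟩
    have h1 := hK (EuclideanSpace.single 0 1) (by simp)
    simp at h1
    exact (norm_nonneg _).trans h1
  have hbc := CommAux.lip_cont hα b hb
  have hF : Measurable fun x => ‖f x‖ₑ := hf.enorm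
  set L := lipSeminorm α b with hL
  set N := (morreyNorm p q f).toReal with hNdef
  set B := A * L.toReal with hBdef
  have hN0 : 0 ≤ N := ENNReal.toReal_nonneg
  have hB0 : 0 ≤ B := by positivity
  have hNeq : morreyNorm p q f = ENNReal.ofReal N := (ENNReal.ofReal_toReal hfM.ne).symm
  have hBeq : ENNReal.ofReal A * L = ENNReal.ofReal B := by
    rw [hBdef, ENNReal.ofReal_mul hA, ENNReal.ofReal_toReal hb.ne]
  have hker : ∀ x, ∫⁻ y, ‖((b x - b y : ℝ) : ℂ) * K (x - y) * f y‖ₑ ≤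
      ENNReal.ofReal B * CommAux.riesz α (fun x => ‖f x‖ₑ) x := by
    intro x
    rw [CommAux.riesz, ← lintegral_const_mul' _ _ ENNReal.ofReal_ne_top, ← hBeq]
    exact lintegral_mono fun y => CommAux.kernel_le hα hA K hK b f x y
  refine ⟨?_, ?_⟩
  · filter_upwards [CommAux.riesz_ae_lt_top hn hα hα1 hF
      (CommAux.mor_of_morrey f hNeq.le hN0) hN0 hq he] with x hx
    refine ⟨Measurable.aestronglyMeasurable ?_, ?_⟩
    · have := hbc.measurable
      fun_prop
    · exact (hker x).trans_lt (ENNReal.mul_lt_top ENNReal.ofReal_lt_top hx)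
  · have hfin : ∀ ε : ℝ, 0 < ε →
        weakMorreyNorm s t (fun x => ∫ y, ((b x - b y : ℝ) : ℂ) * K (x - y) * f y) ≤
          ENNReal.ofReal (CommAux.cc n α p s * ((B + ε) * (N + ε))) := by
      intro ε hε
      refine CommAux.weak_bound hn hα hα1 hF
        (CommAux.mor_of_morrey f (hNeq.le.trans (ENNReal.ofReal_le_ofReal (by linarith)))
          (by positivity)) (by positivity) (by positivity) hq hqp ht hts hs htq _ fun x => ?_
      refine (enorm_integral_le_lintegral_enorm _).trans ((hker x).trans ?_)
      gcongr
      linarith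
    have hlim : Filter.Tendsto (fun ε : ℝ => ENNReal.ofReal (CommAux.cc n α p s * ((B + ε) * (N + ε))))
        (nhdsWithin 0 (Set.Ioi 0)) (nhds (ENNReal.ofReal (CommAux.cc n α p s * (B * N)))) := by
      have hc : Continuous fun ε : ℝ => ENNReal.ofReal (CommAux.cc n α p s * ((B + ε) * (N + ε))) :=
        ENNReal.continuous_ofReal.comp (by fun_prop)
      have := (hc.tendsto 0).mono_left (nhdsWithin_le_nhds (s := Set.Ioi 0))
      simpa using this
    have h1 := ge_of_tendsto hlim (by
      filter_upwards [self_mem_nhdsWithin] with ε hε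
      exact hfin ε hε)
    refine h1.trans (le_of_eq ?_)
    rw [mul_assoc (ENNReal.ofReal _) (ENNReal.ofReal A), hBeq, hNeq,
      ENNReal.ofReal_mul hcc.le, ENNReal.ofReal_mul hB0, ← mul_assoc]
end
end

section
/- Let 0 < α < 1, 1 ≤ q ≤ p < ∞, 1 < t ≤ s < ∞ with 1/s = 1/p − α/n and 1/t = 1/q − α/n, and suppose there is a constant M such that ‖[b,T]f‖_{WM^s_t} ≤ M ‖f‖_{M^p_q} for every bounded measurable complex-valued function f supported in a cube. Then sup_Q |Q|^{−(1+α/n)} ∫_Q |b(x) − b_Q| dx ≤ C M with C depending only on n, α, p, q and Ω; consequently b agrees almost everywhere with a function in Lip_α whose seminorm is at most C′ M. -/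
open MeasureTheory ENNReal

noncomputable section

lemma cube_eq_preimage {n : ℕ} (c : En n) (r : ℝ) :
    cube c r = (@WithLp.ofLp 2 (Fin n → ℝ)) ⁻¹'
      (Set.univ.pi fun i => Set.Ioo (c i - r) (c i + r)) := by
  ext y
  simp only [cube, Set.mem_ofPred_eq, Set.mem_preimage, Set.mem_pi, Set.mem_univ, true_imp_iff,
    Set.mem_Ioo, abs_lt]
  refine forall_congr' fun i => ?_
  constructor <;> rintro ⟨h1, h2⟩ <;> constructor <;> linarith

lemma isOpen_cube {n : ℕ} (c : En n) (r : ℝ) : IsOpen (cube c r) := by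
  have : cube c r = ⋂ i, {y : En n | |y i - c i| < r} := by
    ext y; simp [cube]
  rw [this]
  refine isOpen_iInter_of_finite fun i => ?_
  exact isOpen_lt (by fun_prop) continuous_const

lemma volume_cube {n : ℕ} (c : En n) {r : ℝ} (hr : 0 < r) :
    volume (cube c r) = ENNReal.ofReal ((2 * r) ^ n) := by
  rw [cube_eq_preimage, (PiLp.volume_preserving_ofLp (Fin n)).measure_preimage
    (MeasurableSet.univ_pi fun i => measurableSet_Ioo).nullMeasurableSet, Real.volume_pi_Ioo]
  simp only [add_sub_sub_cancel, Finset.prod_const, Finset.card_univ, Fintype.card_fin]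
  rw [ENNReal.ofReal_pow (by positivity), two_mul]

lemma norm_le_of_coord {n : ℕ} (e : En n) {ρ : ℝ} (h : ∀ i, |e i| ≤ ρ) :
    ‖e‖ ≤ n * ρ := by
  have h1 : ‖e‖ ≤ ∑ i, |e i| := by
    rw [EuclideanSpace.norm_eq]
    apply Real.sqrt_le_iff.2
    refine ⟨Finset.sum_nonneg fun i _ => abs_nonneg _, ?_⟩
    simp only [Real.norm_eq_abs]
    exact Finset.sum_sq_le_sq_sum_of_nonneg fun i _ => abs_nonneg _
  refine h1.trans ?_
  calc ∑ i, |e i| ≤ ∑ i : Fin n, ρ := Finset.sum_le_sum fun i _ => h i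
    _ = n * ρ := by simp

lemma exists_median (μ : Measure ℝ) [IsProbabilityMeasure μ] :
    ∃ m : ℝ, (1 / 2 : ℝ) ≤ μ.real (Set.Iic m) ∧ (1 / 2 : ℝ) ≤ μ.real (Set.Ici m) := by
  set F := ProbabilityTheory.cdf μ with hF
  have hFe : ∀ x, F x = μ.real (Set.Iic x) := fun x => ProbabilityTheory.cdf_eq_real μ x
  have hbot := ProbabilityTheory.tendsto_cdf_atBot μ
  have htop := ProbabilityTheory.tendsto_cdf_atTop μ
  set S : Set ℝ := {a | (1 / 2 : ℝ) ≤ F a} with hS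
  have hne : S.Nonempty := by
    obtain ⟨a, ha⟩ := (htop.eventually (lt_mem_nhds (show (1/2 : ℝ) < 1 by norm_num))).exists
    exact ⟨a, ha.le⟩
  have hbdd : BddBelow S := by
    obtain ⟨a, ha⟩ := (hbot.eventually (gt_mem_nhds (show (0 : ℝ) < 1/2 by norm_num))).exists
    refine ⟨a, fun y hy => ?_⟩
    by_contra hlt
    have := ProbabilityTheory.monotone_cdf μ (not_le.1 hlt).le
    have hy' : (1/2 : ℝ) ≤ F y := hy
    linarith
  have hlt : ∀ x < sInf S, F x < 1 / 2 := fun x hx => not_le.1 fun h =>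
    (not_lt.2 (csInf_le hbdd h)) hx
  have hgt : ∀ x, sInf S < x → 1 / 2 ≤ F x := fun x hx => by
    obtain ⟨a, ha, hax⟩ := exists_lt_of_csInf_lt hne hx
    exact le_trans ha (ProbabilityTheory.monotone_cdf μ hax.le)
  refine ⟨sInf S, ?_, ?_⟩
  · rw [← hFe]
    have hc : Filter.Tendsto F (nhdsWithin (sInf S) (Set.Ioi (sInf S))) (nhds (F (sInf S))) :=
      ((F.right_continuous (sInf S)).mono Set.Ioi_subset_Ici_self)
    exact ge_of_tendsto hc (Filter.eventually_of_mem self_mem_nhdsWithin fun x hx => hgt x hx)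
  · have hmono : Monotone fun k : ℕ => Set.Iic (sInf S - 1 / ((k : ℝ) + 1)) := by
      intro i j hij x hx
      simp only [Set.mem_Iic] at *
      have : 1 / ((j : ℝ) + 1) ≤ 1 / ((i : ℝ) + 1) := by
        apply one_div_le_one_div_of_le (by positivity); gcongr
      linarith
    have hU : ⋃ k : ℕ, Set.Iic (sInf S - 1 / ((k : ℝ) + 1)) = Set.Iio (sInf S) := by
      ext x
      simp only [Set.mem_iUnion, Set.mem_Iic, Set.mem_Iio]
      constructor
      · rintro ⟨k, hk⟩
        have : 0 < 1 / ((k : ℝ) + 1) := by positivity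
        linarith
      · intro hx
        obtain ⟨k, hk⟩ := exists_nat_one_div_lt (sub_pos.2 hx)
        exact ⟨k, by linarith⟩
    have ht := tendsto_measure_iUnion_atTop (μ := μ) hmono
    rw [hU] at ht
    have hle : μ (Set.Iio (sInf S)) ≤ ENNReal.ofReal (1 / 2) := by
      refine le_of_tendsto' ht fun k => ?_
      have h1 := hlt (sInf S - 1 / ((k : ℝ) + 1)) (by
        have : 0 < 1 / ((k : ℝ) + 1) := by positivity
        linarith)
      rw [hFe] at h1
      have : μ (Set.Iic (sInf S - 1 / ((k : ℝ) + 1))) =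
          ENNReal.ofReal (μ.real (Set.Iic (sInf S - 1 / ((k : ℝ) + 1)))) := by
        simp [Measure.real]
      simp only [Function.comp] at *
      rw [this]
      exact ENNReal.ofReal_le_ofReal h1.le
    have hle' : μ.real (Set.Iio (sInf S)) ≤ 1 / 2 := ENNReal.toReal_le_of_le_ofReal (by norm_num) hle
    have hcompl := probReal_compl_eq_one_sub (μ := μ) (s := Set.Iio (sInf S)) measurableSet_Iio
    rw [Set.compl_Iio] at hcompl
    rw [hcompl]; linarith

lemma layercake_weak {X : Type*} [MeasurableSpace X] (μ : Measure X) (g : X → ℝ)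
    (hg : AEMeasurable g μ) (hg0 : ∀ x, 0 ≤ g x) {V H t : ℝ} (hV : 0 ≤ V) (hH : 0 < H)
    (ht : 1 < t) (hμ : μ Set.univ ≤ ENNReal.ofReal V)
    (hw : ∀ l : ℝ, 0 < l → μ {x | l < g x} ≤ ENNReal.ofReal (2 * V * (H / l) ^ t)) :
    ∫⁻ x, ENNReal.ofReal (g x) ∂μ ≤ ENNReal.ofReal (V * H * (1 + 2 / (t - 1))) := by
  rw [lintegral_eq_lintegral_meas_lt μ (Filter.Eventually.of_forall hg0) hg]
  have hsplit : Set.Ioi (0 : ℝ) = Set.Ioc 0 H ∪ Set.Ioi H := (Set.Ioc_union_Ioi_eq_Ioi hH.le).symm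
  rw [hsplit]
  refine (lintegral_union_le _ _ _).trans ?_
  have h1 : ∫⁻ l in Set.Ioc 0 H, μ {a | l < g a} ≤ ENNReal.ofReal (V * H) := by
    calc ∫⁻ l in Set.Ioc 0 H, μ {a | l < g a} ≤ ∫⁻ l in Set.Ioc 0 H, ENNReal.ofReal V :=
          lintegral_mono fun l => (measure_mono (Set.subset_univ _)).trans hμ
      _ = ENNReal.ofReal (V * H) := by
          rw [setLIntegral_const, Real.volume_Ioc, sub_zero, ENNReal.ofReal_mul hV]
  have hInt : IntegrableOn (fun l : ℝ => (2 * V * H ^ t) * l ^ (-t)) (Set.Ioi H) :=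
    (integrableOn_Ioi_rpow_of_lt (by linarith) hH).const_mul _
  have h2 : ∫⁻ l in Set.Ioi H, μ {a | l < g a} ≤ ENNReal.ofReal (V * H * (2 / (t - 1))) := by
    calc ∫⁻ l in Set.Ioi H, μ {a | l < g a}
        ≤ ∫⁻ l in Set.Ioi H, ENNReal.ofReal ((2 * V * H ^ t) * l ^ (-t)) := by
          refine setLIntegral_mono' measurableSet_Ioi fun l hl => ?_
          have hl' : 0 < l := hH.trans hl
          refine (hw l hl').trans (le_of_eq ?_)
          rw [Real.div_rpow hH.le hl'.le, Real.rpow_neg hl'.le]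
          congr 1; ring
      _ = ENNReal.ofReal (∫ l in Set.Ioi H, (2 * V * H ^ t) * l ^ (-t)) := by
          rw [ofReal_integral_eq_lintegral_ofReal hInt]
          refine (ae_restrict_iff' measurableSet_Ioi).2 (Filter.Eventually.of_forall fun l hl => ?_)
          have hl' : 0 < l := hH.trans hl
          simp only [Pi.zero_apply]
          positivity
      _ = ENNReal.ofReal (V * H * (2 / (t - 1))) := by
          congr 1
          rw [integral_const_mul, integral_Ioi_rpow_of_lt (by linarith) hH]
          have : H ^ t * H ^ (-t + 1) = H := by
            rw [← Real.rpow_add hH]; simp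
          have h3 : t - 1 ≠ 0 := by linarith
          have h4 : -t + 1 ≠ 0 := by linarith
          have h5 : -H ^ (-t+1) / (-t+1) = H ^ (-t+1) / (t-1) := by
            rw [show -t + 1 = -(t-1) by ring, neg_div_neg_eq]
          rw [h5]
          calc 2 * V * H ^ t * (H ^ (-t + 1) / (t - 1)) = 2 * V * (H ^ t * H ^ (-t + 1)) / (t-1) := by ring
            _ = _ := by rw [this]; ring
  refine (add_le_add h1 h2).trans (le_of_eq ?_)
  have : 0 < t - 1 := by linarith
  rw [← ENNReal.ofReal_add (by positivity) (by positivity)]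
  congr 1; ring

lemma morrey_indicator_le {n : ℕ} {p q : ℝ} (hq : 1 ≤ q) (hqp : q ≤ p) (F : Set (En n))
    (hF : MeasurableSet F) {V : ℝ} (hV : 0 < V) (hFV : volume F ≤ ENNReal.ofReal V) :
    morreyNorm p q (F.indicator fun _ => (1 : ℂ)) ≤ ENNReal.ofReal (V ^ (1 / p)) := by
  unfold morreyNorm
  have hq0 : 0 < q := by linarith
  have hp0 : 0 < p := by linarith
  refine iSup_le fun c => iSup_le fun r => iSup_le fun hr => ?_
  have hInt : ∫⁻ y in cube c r, (‖F.indicator (fun _ => (1 : ℂ)) y‖₊ : ℝ≥0∞) ^ q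
      = volume (F ∩ cube c r) := by
    have : ∀ y, (‖F.indicator (fun _ => (1 : ℂ)) y‖₊ : ℝ≥0∞) ^ q = F.indicator 1 y := by
      intro y
      by_cases hy : y ∈ F <;> simp [hy, hq0]
    simp_rw [this]
    rw [lintegral_indicator_one hF, Measure.restrict_apply hF]
  rw [hInt, volume_cube c hr]
  set W := (2 * r) ^ n with hW
  have hW0 : 0 < W := by positivity
  have hpq : 1 / p - 1 / q ≤ 0 := by
    have := one_div_le_one_div_of_le hq0 hqp
    linarith
  have hmin : volume (F ∩ cube c r) ≤ ENNReal.ofReal (min V W) := by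
    rw [ENNReal.ofReal_min]
    refine le_min ((measure_mono Set.inter_subset_left).trans hFV) ?_
    rw [← volume_cube c hr]
    exact measure_mono Set.inter_subset_right
  have hm0 : 0 < min V W := lt_min hV hW0
  calc ENNReal.ofReal W ^ (1 / p - 1 / q) * volume (F ∩ cube c r) ^ (1 / q)
      ≤ ENNReal.ofReal W ^ (1 / p - 1 / q) * ENNReal.ofReal (min V W) ^ (1 / q) := by gcongr
    _ = ENNReal.ofReal (W ^ (1 / p - 1 / q) * (min V W) ^ (1 / q)) := by
        rw [ENNReal.ofReal_rpow_of_pos hW0, ENNReal.ofReal_rpow_of_pos hm0,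
          ENNReal.ofReal_mul (by positivity)]
    _ ≤ ENNReal.ofReal (V ^ (1 / p)) := by
        apply ENNReal.ofReal_le_ofReal
        calc W ^ (1 / p - 1 / q) * (min V W) ^ (1 / q)
            ≤ (min V W) ^ (1 / p - 1 / q) * (min V W) ^ (1 / q) := by
              gcongr ?_ * _
              exact Real.rpow_le_rpow_of_nonpos hm0 (min_le_right _ _) hpq
          _ = (min V W) ^ (1 / p) := by rw [← Real.rpow_add hm0]; ring_nf
          _ ≤ V ^ (1 / p) := Real.rpow_le_rpow hm0.le (min_le_left _ _) (by positivity)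

lemma exists_kernel_data {n : ℕ} (hn : 0 < n) (Ω : En n → ℝ)
    (hΩhom : ∀ l : ℝ, 0 < l → ∀ x : En n, x ≠ 0 → Ω (l • x) = Ω x)
    (hΩc : ContinuousOn Ω {(0 : En n)}ᶜ)
    (hΩne : ∃ x : En n, x ≠ 0 ∧ Ω x ≠ 0) :
    ∃ (z : En n) (k D σ : ℝ), 0 < k ∧ 0 ≤ D ∧ (σ = 1 ∨ σ = -1) ∧
      ∀ (c : En n) (r : ℝ), 0 < r → ∀ x y : En n, (∀ i, |x i - c i| ≤ r) →
        (∀ i, |y i - (c - r • z) i| ≤ r) →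
        x - y ≠ 0 ∧ k / r ^ n ≤ σ * (Ω (x - y) / ‖x - y‖ ^ n) ∧
          σ * (Ω (x - y) / ‖x - y‖ ^ n) ≤ D / r ^ n := by
  obtain ⟨z0, hz0, hΩz0⟩ := hΩne
  obtain ⟨σ, hσ, hσpos⟩ : ∃ σ : ℝ, (σ = 1 ∨ σ = -1) ∧ 0 < σ * Ω z0 := by
    rcases lt_or_gt_of_ne hΩz0 with h | h
    · exact ⟨-1, Or.inr rfl, by linarith⟩
    · exact ⟨1, Or.inl rfl, by linarith⟩
  set ω := σ * Ω z0 with hω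
  have hcont : ContinuousAt (fun z => σ * Ω z) z0 :=
    continuousAt_const.mul (hΩc.continuousAt (isOpen_compl_singleton.mem_nhds hz0))
  have hev : ∀ᶠ z in nhds z0, ω / 2 < σ * Ω z ∧ σ * Ω z < 2 * ω :=
    (hcont.eventually (lt_mem_nhds (by linarith : ω / 2 < σ * Ω z0))).and
      (hcont.eventually (gt_mem_nhds (by linarith : σ * Ω z0 < 2 * ω)))
  obtain ⟨δ0, hδ0, hball⟩ := Metric.eventually_nhds_iff.1 hev
  have hzn : 0 < ‖z0‖ := norm_pos_iff.2 hz0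
  set δ := min δ0 (‖z0‖ / 2) with hδ
  have hδpos : 0 < δ := lt_min hδ0 (by linarith)
  set Λ : ℝ := 2 * n / δ + 1 with hΛ
  have hΛpos : 0 < Λ := by positivity
  refine ⟨Λ • z0, (ω / 2) / (Λ * (2 * ‖z0‖)) ^ n, 2 * ω / (Λ * (‖z0‖ / 2)) ^ n, σ,
    by positivity, by positivity, hσ, ?_⟩
  intro c r hr x y hx hy
  set e : En n := (x - c) - (y - (c - r • Λ • z0)) with he
  have hen : ‖e‖ ≤ n * (2 * r) := by
    apply norm_le_of_coord
    intro i
    have : e i = (x i - c i) - (y i - (c - r • Λ • z0) i) := by simp [he]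
    rw [this]
    have h1 := hx i
    have h2 := hy i
    rw [abs_le] at *
    constructor <;> linarith [h1.1, h1.2, h2.1, h2.2]
  have hxy : x - y = (Λ * r) • z0 + e := by
    rw [he, mul_comm, mul_smul]; abel
  set w : En n := (Λ * r)⁻¹ • (x - y) with hw
  have hΛr : 0 < Λ * r := by positivity
  have hwz : w - z0 = (Λ * r)⁻¹ • e := by
    rw [hw, hxy, smul_add, smul_smul, inv_mul_cancel₀ hΛr.ne', one_smul]; abel
  have hdist : ‖w - z0‖ < δ := by
    rw [hwz, norm_smul, norm_inv, Real.norm_of_nonneg hΛr.le, inv_mul_lt_iff₀ hΛr]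
    refine hen.trans_lt ?_
    have : Λ * r * δ = n * (2 * r) + r * δ := by
      rw [hΛ]; field_simp
    rw [this]
    have := mul_pos hr hδpos
    linarith
  have hxyw : x - y = (Λ * r) • w := by
    rw [hw, smul_smul, mul_inv_cancel₀ hΛr.ne', one_smul]
  have hwn1 : ‖z0‖ / 2 < ‖w‖ := by
    have h1 : ‖z0‖ ≤ ‖w‖ + ‖w - z0‖ := by
      have := norm_sub_le w (w - z0); simpa using this
    have h2 : δ ≤ ‖z0‖ / 2 := min_le_right _ _
    linarith
  have hwn2 : ‖w‖ < 2 * ‖z0‖ := by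
    have h1 : ‖w‖ ≤ ‖w - z0‖ + ‖z0‖ := by
      have := norm_add_le (w - z0) z0; simpa using this
    have h2 : δ ≤ ‖z0‖ / 2 := min_le_right _ _
    linarith
  have hw0 : w ≠ 0 := by
    rw [← norm_pos_iff]; linarith
  obtain ⟨hb1, hb2⟩ := hball (y := w) (by
    rw [dist_eq_norm]; exact hdist.trans_le (min_le_left _ _))
  have hΩeq : Ω (x - y) = Ω w := by rw [hxyw, hΩhom _ hΛr w hw0]
  have hnorm : ‖x - y‖ = Λ * r * ‖w‖ := by
    rw [hxyw, norm_smul, Real.norm_of_nonneg hΛr.le]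
  have hwpos : 0 < ‖w‖ := by linarith
  refine ⟨?_, ?_, ?_⟩
  · rw [hxyw]; exact smul_ne_zero hΛr.ne' hw0
  · rw [hΩeq, hnorm, ← mul_div_assoc, div_div, ← mul_pow]
    apply div_le_div₀ (by linarith) hb1.le (by positivity)
    apply pow_le_pow_left₀ (by positivity)
    have := mul_le_mul_of_nonneg_left hwn2.le hΛr.le
    linarith
  · rw [hΩeq, hnorm, ← mul_div_assoc, div_div, ← mul_pow]
    apply div_le_div₀ (by linarith) hb2.le (by positivity)
    apply pow_le_pow_left₀ (by positivity)
    have := mul_le_mul_of_nonneg_left hwn1.le hΛr.le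
    linarith

lemma commutator_lower {n : ℕ} (Ω : En n → ℝ)
    (hΩc : ContinuousOn Ω {(0 : En n)}ᶜ)
    (z : En n) (k D σ : ℝ) (hk : 0 < k) (hσ : σ = 1 ∨ σ = -1)
    (hK : ∀ (c : En n) (r : ℝ), 0 < r → ∀ x y : En n, (∀ i, |x i - c i| ≤ r) →
        (∀ i, |y i - (c - r • z) i| ≤ r) →
        x - y ≠ 0 ∧ k / r ^ n ≤ σ * (Ω (x - y) / ‖x - y‖ ^ n) ∧
          σ * (Ω (x - y) / ‖x - y‖ ^ n) ≤ D / r ^ n)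
    (T : (En n → ℂ) → (En n → ℂ)) (b b0 : En n → ℝ) (hb : LocallyIntegrable b volume)
    (hbb : b =ᵐ[volume] b0)
    (hT : ∀ f : En n → ℂ, Integrable f → HasCompactSupport f →
          ∀ᵐ x : En n, x ∉ tsupport f →
            T f x = ∫ y, ((Ω (x - y) / ‖x - y‖ ^ n : ℝ) : ℂ) * f y)
    (c : En n) (r : ℝ) (hr : 0 < r) (F : Set (En n)) (hF : MeasurableSet F)
    (hFQ : F ⊆ cube (c - r • z) r) (τ m : ℝ) (hFm : ∀ y ∈ F, τ * (b0 y - m) ≤ 0)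
    (hτ : τ = 1 ∨ τ = -1) :
    ∀ᵐ x : En n, x ∈ cube c r → 0 ≤ τ * (b x - m) →
      k / r ^ n * volume.real F * (τ * (b x - m)) ≤
        ‖(b x : ℂ) * T (F.indicator fun _ => (1 : ℂ)) x
          - T (fun y => (b y : ℂ) * F.indicator (fun _ => (1 : ℂ)) y) x‖ := by
  set f : En n → ℂ := F.indicator fun _ => (1 : ℂ) with hf
  set P : Set (En n) := {y | ∀ i, |y i - (c - r • z) i| ≤ r} with hP
  have hPclosed : IsClosed P := by
    have : P = ⋂ i, {y : En n | |y i - (c - r • z) i| ≤ r} := by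
      ext y; simp [hP]
    rw [this]
    exact isClosed_iInter fun i => isClosed_le (by fun_prop) continuous_const
  have hPbdd : Bornology.IsBounded P := by
    refine (Metric.isBounded_closedBall (x := c - r • z) (r := n * r)).subset fun y hy => ?_
    rw [Metric.mem_closedBall, dist_eq_norm]
    exact norm_le_of_coord _ fun i => by simpa using hy i
  have hPc : IsCompact P := Metric.isCompact_of_isClosed_isBounded hPclosed hPbdd
  have hFP : F ⊆ P := fun y hy i => (hFQ hy i).le
  have hsupp : tsupport f ⊆ P := by
    refine closure_minimal ?_ hPclosed
    exact Set.support_indicator_subset.trans hFP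
  have hfc : HasCompactSupport f := hPc.of_isClosed_subset (isClosed_tsupport f) hsupp
  have hFfin : volume F ≠ ∞ := ((measure_mono hFP).trans_lt hPc.measure_lt_top).ne
  have hfi : Integrable f := (integrable_indicator_iff hF).2 (integrableOn_const hFfin)
  set g : En n → ℂ := fun y => (b y : ℂ) * f y with hg
  have hgsub : tsupport g ⊆ tsupport f := closure_mono fun y hy => by
    simp only [hg, Function.mem_support] at hy ⊢
    exact right_ne_zero_of_mul hy
  have hgc : HasCompactSupport g := hfc.of_isClosed_subset (isClosed_tsupport g) hgsub
  have hbF : IntegrableOn b F := (hb.integrableOn_isCompact hPc).mono_set hFP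
  have hgeq : g = F.indicator fun y => (b y : ℂ) := by
    funext y
    by_cases hy : y ∈ F <;> simp [hg, hf, hy]
  have hgi : Integrable g := by
    rw [hgeq]
    exact (integrable_indicator_iff hF).2 hbF.ofReal
  filter_upwards [hT f hfi hfc, hT g hgi hgc] with x hx1 hx2 hxQ hxm
  have hxle : ∀ i, |x i - c i| ≤ r := fun i => (hxQ i).le
  have hxP : x ∉ P := fun hxP => (hK c r hr x x hxle hxP).1 (sub_self x)
  have e1 := hx1 fun h => hxP (hsupp h)
  have e2 := hx2 fun h => hxP (hsupp (hgsub h))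
  set K : En n → ℝ := fun y => Ω (x - y) / ‖x - y‖ ^ n with hKdef
  have hKcont : ContinuousOn K P := by
    have hmaps : Set.MapsTo (fun y : En n => x - y) P {(0 : En n)}ᶜ := fun y hy =>
      (hK c r hr x y hxle hy).1
    refine ContinuousOn.div (hΩc.comp (by fun_prop) hmaps) (by fun_prop) fun y hy => ?_
    exact pow_ne_zero _ (norm_ne_zero_iff.2 (hmaps hy))
  have hKm : AEStronglyMeasurable K (volume.restrict F) :=
    (hKcont.aestronglyMeasurable hPclosed.measurableSet).mono_measure (Measure.restrict_mono hFP le_rfl)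
  have hKb : ∀ y ∈ F, ‖K y‖ ≤ D / r ^ n := fun y hy => by
    obtain ⟨-, h1, h2⟩ := hK c r hr x y hxle (hFP hy)
    have hpos : 0 < k / r ^ n := by positivity
    have : ‖K y‖ = |σ * K y| := by
      rcases hσ with rfl | rfl <;> simp
    rw [this, abs_of_nonneg (hpos.le.trans h1)]
    exact h2
  have hKb' : ∀ᵐ y ∂(volume.restrict F), ‖K y‖ ≤ D / r ^ n :=
    (ae_restrict_iff' hF).2 (Filter.Eventually.of_forall hKb)
  have hKi : IntegrableOn K F :=
    Integrable.mono' (integrableOn_const (C := D / r ^ n) hFfin) hKm hKb'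
  have hKbi : IntegrableOn (fun y => K y * b y) F :=
    hbF.bdd_mul hKm hKb'
  have i1 : ∫ y, ((K y : ℝ) : ℂ) * f y = ((∫ y in F, K y : ℝ) : ℂ) := by
    rw [← integral_indicator hF, ← integral_complex_ofReal]
    congr 1; funext y
    by_cases hy : y ∈ F <;> simp [hf, hy]
  have i2 : ∫ y, ((K y : ℝ) : ℂ) * g y = ((∫ y in F, K y * b y : ℝ) : ℂ) := by
    rw [← integral_indicator hF, ← integral_complex_ofReal]
    congr 1; funext y
    by_cases hy : y ∈ F <;> simp [hg, hf, hy]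
  have hcomm : (b x : ℂ) * T f x - T g x = ((∫ y in F, K y * (b x - b y) : ℝ) : ℂ) := by
    rw [e1, e2, i1, i2, ← Complex.ofReal_mul, ← Complex.ofReal_sub]
    congr 1
    rw [← integral_const_mul, ← integral_sub (hKi.const_mul _) hKbi]
    congr 1; funext y; ring
  rw [hcomm, Complex.norm_real]
  have hIi : IntegrableOn (fun y => σ * τ * (K y * (b x - b y))) F := by
    have : (fun y => σ * τ * (K y * (b x - b y))) = fun y => σ * τ * (b x * K y - K y * b y) := by
      funext y; ring
    rw [this]
    exact ((hKi.const_mul _).sub hKbi).const_mul _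
  have hlow : k / r ^ n * volume.real F * (τ * (b x - m)) ≤
      ∫ y in F, σ * τ * (K y * (b x - b y)) := by
    calc k / r ^ n * volume.real F * (τ * (b x - m))
        = ∫ y in F, k / r ^ n * (τ * (b x - m)) := by
          rw [setIntegral_const, smul_eq_mul]; ring
      _ ≤ _ := by
          refine integral_mono_ae (integrableOn_const hFfin) hIi ?_
          filter_upwards [ae_restrict_mem hF, ae_restrict_of_ae hbb] with y hy hby
          obtain ⟨-, h1, -⟩ := hK c r hr x y hxle (hFP hy)
          have h2 := hFm y hy
          rw [← hby] at h2
          have hpos : 0 < k / r ^ n := by positivity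
          calc k / r ^ n * (τ * (b x - m)) ≤ (σ * K y) * (τ * (b x - b y)) := by
                apply mul_le_mul h1 _ hxm (hpos.le.trans h1)
                linarith
            _ = _ := by ring
  refine hlow.trans ?_
  rw [integral_const_mul]
  refine (le_abs_self _).trans (le_of_eq ?_)
  rw [abs_mul, Real.norm_eq_abs]
  rcases hσ with rfl | rfl <;> rcases hτ with rfl | rfl <;> simp

lemma ballAvg_sub_cubeAvg {n : ℕ} {α A : ℝ} (b : En n → ℝ) (hb : LocallyIntegrable b volume)
    (hA : 0 ≤ A)
    (h : ∀ (c : En n) (R : ℝ), 0 < R →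
      ∫ x in cube c R, |b x - cubeAvg b c R| ≤ A * (2 * R) ^ (n + α))
    (y c : En n) {ρ R l : ℝ} (hρ : 0 < ρ) (hR : 0 < R) (hl : 0 < l) (hlR : R / l ≤ ρ)
    (hsub : Metric.closedBall y ρ ⊆ cube c R) :
    |(⨍ x in Metric.closedBall y ρ, b x) - cubeAvg b c R| ≤
      A * (2 ^ (n + α) * l ^ n / volume.real (Metric.ball (0 : En n) 1)) * R ^ α := by
  set B := Metric.closedBall y ρ with hB
  have hBi : IntegrableOn b B := hb.integrableOn_isCompact (isCompact_closedBall y ρ)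
  set ω := volume.real (Metric.ball (0 : En n) 1) with hω
  have hωpos : 0 < ω := ENNReal.toReal_pos (Metric.measure_ball_pos _ _ one_pos).ne'
    measure_ball_lt_top.ne
  have hBv : volume.real B = ρ ^ n * ω := by
    rw [hB, Measure.real, Measure.addHaar_closedBall _ _ hρ.le, ENNReal.toReal_mul,
      ENNReal.toReal_ofReal (by positivity)]
    simp [hω, Measure.real]
  have hBpos : 0 < volume.real B := by rw [hBv]; positivity
  have hBfin : volume B ≠ ∞ := measure_closedBall_lt_top.ne
  have hQbdd : cube c R ⊆ Metric.closedBall c (n * R) := fun z hz => by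
    rw [Metric.mem_closedBall, dist_eq_norm]
    exact norm_le_of_coord _ fun i => by simpa using (hz i).le
  have hQi : IntegrableOn b (cube c R) :=
    (hb.integrableOn_isCompact (isCompact_closedBall c (n * R))).mono_set hQbdd
  have hQfin : volume (cube c R) ≠ ∞ := by rw [volume_cube c hR]; exact ENNReal.ofReal_ne_top
  set a := cubeAvg b c R with ha
  have e1 : (⨍ x in B, b x) - a = (volume.real B)⁻¹ * ∫ x in B, (b x - a) := by
    rw [integral_sub hBi (integrableOn_const hBfin), setIntegral_const, setAverage_eq, smul_eq_mul,
      smul_eq_mul]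
    field_simp
  have e2 : |∫ x in B, (b x - a)| ≤ A * (2 * R) ^ (n + α) := by
    calc |∫ x in B, (b x - a)| ≤ ∫ x in B, |b x - a| := abs_integral_le_integral_abs
      _ ≤ ∫ x in cube c R, |b x - a| :=
          setIntegral_mono_set (hQi.sub (integrableOn_const hQfin)).abs
            (Filter.Eventually.of_forall fun x => abs_nonneg _) (Filter.Eventually.of_forall hsub)
      _ ≤ _ := h c R hR
  rw [e1, abs_mul, abs_of_pos (inv_pos.2 hBpos), hBv]
  calc (ρ ^ n * ω)⁻¹ * |∫ x in B, (b x - a)|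
      ≤ ((R / l) ^ n * ω)⁻¹ * (A * (2 * R) ^ (n + α)) := by gcongr
    _ = _ := by
      rw [Real.mul_rpow (by norm_num) hR.le, Real.rpow_add hR, Real.rpow_natCast, div_pow]
      field_simp

lemma closedBall_subset_cube {n : ℕ} (y c : En n) {ρ R : ℝ} (h : dist y c + ρ < R) :
    Metric.closedBall y ρ ⊆ cube c R := fun z hz i => by
  have h1 : |z i - c i| ≤ ‖z - c‖ := by
    simpa using PiLp.norm_apply_le (z - c) i
  rw [← dist_eq_norm] at h1
  have h2 := dist_triangle z y c
  rw [Metric.mem_closedBall] at hz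
  linarith

lemma campanato {n : ℕ} {α : ℝ} (hα : 0 < α) :
    ∃ C2 : ℝ, 0 < C2 ∧ ∀ (A : ℝ) (b : En n → ℝ), 0 ≤ A → LocallyIntegrable b volume →
      (∀ (c : En n) (R : ℝ), 0 < R →
        ∫ x in cube c R, |b x - cubeAvg b c R| ≤ A * (2 * R) ^ (n + α)) →
      ∃ b' : En n → ℝ, lipSeminorm α b' ≤ ENNReal.ofReal (C2 * A) ∧ b =ᵐ[volume] b' := by
  set ω := volume.real (Metric.ball (0 : En n) 1) with hω
  have hωpos : 0 < ω := ENNReal.toReal_pos (Metric.measure_ball_pos _ _ one_pos).ne'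
    measure_ball_lt_top.ne
  set G : ℝ := 2 ^ (n + α) * 4 ^ n / ω with hG
  have hGpos : 0 < G := by positivity
  set θ : ℝ := (1 / 2) ^ α with hθ
  have hθ1 : θ < 1 := Real.rpow_lt_one (by norm_num) (by norm_num) hα
  have hθ0 : 0 < θ := by positivity
  have hθ' : 0 < 1 - θ := by linarith
  refine ⟨2 * (G * 4 ^ α) + 2 * ((2 * G * 2 ^ α) / (1 - θ)), by positivity, ?_⟩
  intro A b hA hb h
  set v : En n → ℝ → ℝ := fun x ρ => ⨍ z in Metric.closedBall x ρ, b z with hv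
  have key : ∀ (y c : En n) (ρ R l : ℝ), 0 < ρ → 0 < R → 0 < l → R / l ≤ ρ → dist y c + ρ < R →
      |v y ρ - cubeAvg b c R| ≤ A * (2 ^ (n + α) * l ^ n / ω) * R ^ α :=
    fun y c ρ R l h1 h2 h3 h4 h5 =>
      ballAvg_sub_cubeAvg b hb hA h y c h1 h2 h3 h4 (closedBall_subset_cube y c h5)
  have hhalf : ∀ k : ℕ, (0 : ℝ) < (1 / 2) ^ k := fun k => by positivity
  have hθk : ∀ k : ℕ, ((1 / 2 : ℝ) ^ k) ^ α = θ ^ k := fun k => by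
    rw [hθ, ← Real.rpow_natCast, ← Real.rpow_natCast, ← Real.rpow_mul (by norm_num),
      ← Real.rpow_mul (by norm_num), mul_comm]
  have step : ∀ (x : En n) (d : ℝ), 0 < d → ∀ k : ℕ,
      dist (v x (d * (1 / 2) ^ k)) (v x (d * (1 / 2) ^ (k + 1))) ≤
        (A * (2 * G * 2 ^ α) * d ^ α) * θ ^ k := by
    intro x d hd k
    have hk := hhalf k
    set s := d * (1 / 2) ^ k with hs
    have hspos : 0 < s := by positivity
    have hs2 : d * (1 / 2) ^ (k + 1) = s / 2 := by rw [hs, pow_succ]; ring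
    rw [hs2, Real.dist_eq]
    have k1 := key x x s (2 * s) 4 hspos (by positivity) (by norm_num) (by linarith) (by simp; linarith)
    have k2 := key x x (s / 2) (2 * s) 4 (by positivity) (by positivity) (by norm_num) (by linarith)
      (by simp; linarith)
    have hpow : (2 * s) ^ α = 2 ^ α * (d ^ α * θ ^ k) := by
      rw [Real.mul_rpow (by norm_num) hspos.le, hs, Real.mul_rpow hd.le hk.le, hθk]
    rw [hpow, ← hG] at k1 k2
    have := abs_sub_le (v x s) (cubeAvg b x (2 * s)) (v x (s / 2))
    rw [abs_sub_comm (cubeAvg b x (2 * s))] at this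
    calc _ ≤ _ := this
      _ ≤ _ := add_le_add k1 k2
      _ = _ := by ring
  have hcauchy : ∀ x : En n, ∃ a : ℝ,
      Filter.Tendsto (fun k : ℕ => v x (1 * (1 / 2) ^ k)) Filter.atTop (nhds a) := fun x =>
    cauchySeq_tendsto_of_complete (cauchySeq_of_le_geometric _ _ hθ1 (step x 1 one_pos))
  choose b' hb' using hcauchy
  have hθlim : Filter.Tendsto (fun k : ℕ => θ ^ k) Filter.atTop (nhds 0) :=
    tendsto_pow_atTop_nhds_zero_of_lt_one hθ0.le hθ1
  have hlim : ∀ (x : En n) (d : ℝ), 0 < d →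
      Filter.Tendsto (fun k : ℕ => v x (d * (1 / 2) ^ k)) Filter.atTop (nhds (b' x)) := by
    intro x d hd
    have hdiff : Filter.Tendsto (fun k : ℕ => v x (d * (1 / 2) ^ k) - v x (1 * (1 / 2) ^ k))
        Filter.atTop (nhds 0) := by
      set l : ℝ := (1 + d) / min 1 d with hl
      have hmin : 0 < min 1 d := lt_min one_pos hd
      have hlpos : 0 < l := by positivity
      set E := 2 * (A * (2 ^ (n + α) * l ^ n / ω) * (1 + d) ^ α) with hE
      refine squeeze_zero_norm (a := fun k => E * θ ^ k) (fun k => ?_) (by simpa using hθlim.const_mul E)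
      have hk := hhalf k
      set u : ℝ := (1 / 2) ^ k with hu
      have hRl : (1 + d) * u / l = min 1 d * u := by
        rw [hl]; field_simp
      have k1 := key x x (d * u) ((1 + d) * u) l (by positivity) (by positivity) hlpos
        (by rw [hRl]; gcongr; exact min_le_right _ _) (by simp; linarith)
      have k2 := key x x (1 * u) ((1 + d) * u) l (by positivity) (by positivity) hlpos
        (by rw [hRl]; gcongr; exact min_le_left _ _) (by simp; nlinarith)
      have hpow : ((1 + d) * u) ^ α = (1 + d) ^ α * θ ^ k := by
        rw [Real.mul_rpow (by positivity) hk.le, hu, hθk]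
      rw [hpow] at k1 k2
      have := abs_sub_le (v x (d * u)) (cubeAvg b x ((1 + d) * u)) (v x (1 * u))
      rw [abs_sub_comm (cubeAvg b x ((1 + d) * u))] at this
      rw [Real.norm_eq_abs]
      calc _ ≤ _ := this
        _ ≤ _ := add_le_add k1 k2
        _ = _ := by rw [hE]; ring
    simpa using hdiff.add (hb' x)
  refine ⟨b', ?_, ?_⟩
  · unfold lipSeminorm
    refine iSup_le fun x => iSup_le fun y => iSup_le fun hxy => ?_
    have hd : 0 < dist x y := dist_pos.2 hxy
    set d := dist x y with hdd
    have q1 := dist_le_of_le_geometric_of_tendsto₀ _ _ hθ1 (step x d hd) (hlim x d hd)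
    have q2 := dist_le_of_le_geometric_of_tendsto₀ _ _ hθ1 (step y d hd) (hlim y d hd)
    simp only [pow_zero, mul_one] at q1 q2
    have k1 := key x x d (4 * d) 4 hd (by positivity) (by norm_num) (by linarith) (by simp; linarith)
    have k2 := key y x d (4 * d) 4 hd (by positivity) (by norm_num) (by linarith)
      (by rw [dist_comm]; linarith)
    rw [← hG, Real.mul_rpow (by norm_num) hd.le] at k1 k2
    rw [Real.dist_eq] at q1 q2
    have hfin : |b' x - b' y| ≤
        (2 * (G * 4 ^ α) + 2 * ((2 * G * 2 ^ α) / (1 - θ))) * A * d ^ α := by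
      have e1 : (A * (2 * G * 2 ^ α) * d ^ α) / (1 - θ) =
          A * ((2 * G * 2 ^ α) / (1 - θ)) * d ^ α := by ring
      rw [e1] at q1 q2
      rw [abs_le] at *
      constructor <;> linarith [k1.1, k1.2, k2.1, k2.2, q1.1, q1.2, q2.1, q2.2]
    apply ENNReal.div_le_of_le_mul
    rw [edist_dist, ENNReal.ofReal_rpow_of_pos hd, ← ENNReal.ofReal_mul (by positivity)]
    rw [← enorm_eq_nnnorm, Real.enorm_eq_ofReal_abs]
    exact ENNReal.ofReal_le_ofReal hfin
  · filter_upwards [IsUnifLocDoublingMeasure.ae_tendsto_average (μ := (volume : Measure (En n))) hb 1]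
      with x hx
    refine tendsto_nhds_unique ?_ (hb' x)
    refine hx (fun _ => x) (fun k : ℕ => 1 * (1 / 2) ^ k) ?_ ?_
    · refine tendsto_nhdsWithin_iff.2 ⟨?_, Filter.Eventually.of_forall fun k => ?_⟩
      · simpa using tendsto_pow_atTop_nhds_zero_of_lt_one (r := (1 / 2 : ℝ)) (by norm_num) (by norm_num)
      · have := hhalf k
        simpa using this
    · refine Filter.Eventually.of_forall fun k => ?_
      have := hhalf k
      apply Metric.mem_closedBall_self
      linarith

lemma exists_median_cube {n : ℕ} (b0 : En n → ℝ) (hb0 : Measurable b0) (c : En n) {r : ℝ}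
    (hr : 0 < r) :
    ∃ m : ℝ, (2 * r) ^ n / 2 ≤ volume.real (cube c r ∩ {y | b0 y ≤ m}) ∧
      (2 * r) ^ n / 2 ≤ volume.real (cube c r ∩ {y | m ≤ b0 y}) := by
  have hV : 0 < (2 * r) ^ n := by positivity
  have hvol := volume_cube c hr
  have hfin : volume (cube c r) ≠ ∞ := by rw [hvol]; exact ENNReal.ofReal_ne_top
  have hpos : volume (cube c r) ≠ 0 := by rw [hvol]; simpa using hV
  have hQ : MeasurableSet (cube c r) := (isOpen_cube c r).measurableSet
  haveI : IsProbabilityMeasure (ProbabilityTheory.cond volume (cube c r)) :=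
    ProbabilityTheory.cond_isProbabilityMeasure_of_finite hpos hfin
  haveI : IsProbabilityMeasure ((ProbabilityTheory.cond volume (cube c r)).map b0) :=
    Measure.isProbabilityMeasure_map hb0.aemeasurable
  obtain ⟨m, h1, h2⟩ := exists_median ((ProbabilityTheory.cond volume (cube c r)).map b0)
  have hreal : volume.real (cube c r) = (2 * r) ^ n := by
    rw [Measure.real, hvol, ENNReal.toReal_ofReal hV.le]
  refine ⟨m, ?_, ?_⟩
  · rw [map_measureReal_apply hb0 measurableSet_Iic, Measure.real, ProbabilityTheory.cond_apply hQ, ENNReal.toReal_mul,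
      ENNReal.toReal_inv, ← Measure.real, ← Measure.real, hreal,
      inv_mul_eq_div, le_div_iff₀ hV] at h1
    have : b0 ⁻¹' Set.Iic m = {y | b0 y ≤ m} := rfl
    rw [this] at h1
    linarith
  · rw [map_measureReal_apply hb0 measurableSet_Ici, Measure.real, ProbabilityTheory.cond_apply hQ, ENNReal.toReal_mul,
      ENNReal.toReal_inv, ← Measure.real, ← Measure.real, hreal,
      inv_mul_eq_div, le_div_iff₀ hV] at h2
    have : b0 ⁻¹' Set.Ici m = {y | m ≤ b0 y} := rfl
    rw [this] at h2
    linarith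

lemma weak_level {n : ℕ} {α p s t V M k' l : ℝ} (ht : 1 < t)
    (hs : 1 / s = 1 / p - α / n) (hV : 0 < V) (hM : 0 < M) (hk' : 0 < k')
    (hl : 0 < l) (v : ℝ≥0∞) (hv : v ≠ ∞)
    (h : ENNReal.ofReal V ^ (1 / s - 1 / t) * (ENNReal.ofReal (k' * l) ^ t * v) ^ (1 / t) ≤
      ENNReal.ofReal M * ENNReal.ofReal (V ^ (1 / p))) :
    v ≤ ENNReal.ofReal (V * ((M * V ^ (α / n) / k') / l) ^ t) := by
  lift v to NNReal using hv
  have hkl : 0 < k' * l := by positivity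
  have ht0 : 0 < t := by linarith
  have hv : (v : ℝ≥0∞) = ENNReal.ofReal (v : ℝ) := by simp
  rw [hv] at h ⊢
  have hv0 : (0 : ℝ) ≤ v := v.2
  generalize (v : ℝ) = w at *
  rw [ENNReal.ofReal_rpow_of_pos hV, ENNReal.ofReal_rpow_of_pos hkl,
    ← ENNReal.ofReal_mul (by positivity), ENNReal.ofReal_rpow_of_nonneg (by positivity) (by positivity),
    ← ENNReal.ofReal_mul (by positivity), ← ENNReal.ofReal_mul hM.le,
    ENNReal.ofReal_le_ofReal_iff (by positivity), Real.mul_rpow (by positivity) hv0,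
    ← Real.rpow_mul hkl.le, mul_one_div_cancel ht0.ne', Real.rpow_one] at h
  apply ENNReal.ofReal_le_ofReal
  have h1 : w ^ (1 / t) ≤ V ^ (1 / t) * ((M * V ^ (α / n) / k') / l) := by
    have e : M * V ^ (1 / p) = V ^ (1 / s - 1 / t) *
        ((k' * l) * (V ^ (1 / t) * ((M * V ^ (α / n) / k') / l))) := by
      have : V ^ (1 / p) = V ^ (1 / s - 1 / t) * V ^ (1 / t) * V ^ (α / n) := by
        rw [← Real.rpow_add hV, ← Real.rpow_add hV, hs]; congr 1; ring
      rw [this]; field_simp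
    rw [e] at h
    exact le_of_mul_le_mul_left (le_of_mul_le_mul_left h (by positivity)) hkl
  calc w = (w ^ (1 / t)) ^ t := by
        rw [← Real.rpow_mul hv0, one_div_mul_cancel ht0.ne', Real.rpow_one]
    _ ≤ (V ^ (1 / t) * ((M * V ^ (α / n) / k') / l)) ^ t :=
        Real.rpow_le_rpow (by positivity) h1 ht0.le
    _ = _ := by
        rw [Real.mul_rpow (by positivity) (by positivity), ← Real.rpow_mul hV.le,
          one_div_mul_cancel ht0.ne', Real.rpow_one]

lemma osc_bound {n : ℕ} {α p q s t : ℝ} (hn : 0 < n) (hq : 1 ≤ q) (hqp : q ≤ p) (ht : 1 < t)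
    (hs : 1 / s = 1 / p - α / n) (Ω : En n → ℝ)
    (hΩc : ContinuousOn Ω {(0 : En n)}ᶜ)
    (z : En n) (k D σ : ℝ) (hk : 0 < k) (hσ : σ = 1 ∨ σ = -1)
    (hK : ∀ (c : En n) (r : ℝ), 0 < r → ∀ x y : En n, (∀ i, |x i - c i| ≤ r) →
        (∀ i, |y i - (c - r • z) i| ≤ r) →
        x - y ≠ 0 ∧ k / r ^ n ≤ σ * (Ω (x - y) / ‖x - y‖ ^ n) ∧
          σ * (Ω (x - y) / ‖x - y‖ ^ n) ≤ D / r ^ n)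
    (T : (En n → ℂ) → (En n → ℂ)) (b : En n → ℝ) (hb : LocallyIntegrable b volume)
    (hT : ∀ f : En n → ℂ, Integrable f → HasCompactSupport f →
          ∀ᵐ x : En n, x ∉ tsupport f →
            T f x = ∫ y, ((Ω (x - y) / ‖x - y‖ ^ n : ℝ) : ℂ) * f y)
    (M : ℝ) (hM : 0 < M)
    (hcomm : ∀ f : En n → ℂ, Measurable f → (∃ D : ℝ, ∀ x, ‖f x‖ ≤ D) →
          (∃ (c : En n) (r : ℝ), 0 < r ∧ ∀ x, x ∉ cube c r → f x = 0) →
          weakMorreyNorm s t (fun x => (b x : ℂ) * T f x - T (fun y => (b y : ℂ) * f y) x) ≤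
            ENNReal.ofReal M * morreyNorm p q f)
    (c : En n) (r : ℝ) (hr : 0 < r) :
    ∫ x in cube c r, |b x - cubeAvg b c r| ≤
      (2 * (1 + 2 / (t - 1)) / (k * 2 ^ n / 2) * M) * (2 * r) ^ (n + α) := by
  obtain ⟨b0, hb0s, hbb⟩ := hb.aestronglyMeasurable
  have hb0 : Measurable b0 := hb0s.measurable
  set V : ℝ := (2 * r) ^ n with hV
  have hVpos : 0 < V := by positivity
  set k' : ℝ := k * 2 ^ n / 2 with hk'
  have hk'pos : 0 < k' := by positivity
  set H : ℝ := M * V ^ (α / n) / k' with hH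
  have hHpos : 0 < H := by positivity
  have ht1 : 0 < t - 1 := by linarith
  have hQm : MeasurableSet (cube c r) := (isOpen_cube c r).measurableSet
  have hQ'm : MeasurableSet (cube (c - r • z) r) := (isOpen_cube _ r).measurableSet
  have hvQ : volume (cube c r) = ENNReal.ofReal V := volume_cube c hr
  have hvQ' : volume (cube (c - r • z) r) = ENNReal.ofReal V := volume_cube _ hr
  have hQfin : volume (cube c r) ≠ ∞ := by rw [hvQ]; exact ENNReal.ofReal_ne_top
  obtain ⟨m, hm1, hm2⟩ := exists_median_cube b0 hb0 (c - r • z) hr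
  have one_side : ∀ (τ : ℝ), (τ = 1 ∨ τ = -1) → ∀ F : Set (En n), MeasurableSet F →
      F ⊆ cube (c - r • z) r → (∀ y ∈ F, τ * (b0 y - m) ≤ 0) → V / 2 ≤ volume.real F →
      ∀ l : ℝ, 0 < l → volume {x ∈ cube c r | l < τ * (b x - m)} ≤
        ENNReal.ofReal (V * (H / l) ^ t) := by
    intro τ hτ F hF hFQ hFm hFV l hl
    have hlow := commutator_lower Ω hΩc z k D σ hk hσ hK T b b0 hb hbb hT c r hr F hF hFQ τ m hFm hτ
    have hbd := hcomm (F.indicator fun _ => (1 : ℂ)) (measurable_const.indicator hF)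
      ⟨1, fun x => by by_cases hx : x ∈ F <;> simp [hx]⟩
      ⟨c - r • z, r, hr, fun x hx => Set.indicator_of_notMem (fun h => hx (hFQ h)) _⟩
    set Φ : En n → ℂ := fun x => (b x : ℂ) * T (F.indicator fun _ => (1 : ℂ)) x
          - T (fun y => (b y : ℂ) * F.indicator (fun _ => (1 : ℂ)) y) x with hΦ
    have hmor := morrey_indicator_le hq hqp F hF hVpos ((measure_mono hFQ).trans hvQ'.le)
    have hkl : 0 < k' * l := by positivity
    have hsub : volume {x ∈ cube c r | l < τ * (b x - m)} ≤
        volume {y ∈ cube c r | k' * l < ‖Φ y‖} := by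
      apply measure_mono_ae
      filter_upwards [hlow] with x hx hxS
      obtain ⟨hxQ, hxl⟩ := hxS
      refine ⟨hxQ, ?_⟩
      refine lt_of_lt_of_le ?_ (hx hxQ (hl.le.trans hxl.le))
      have hkk : k' ≤ k / r ^ n * volume.real F := by
        calc k' = k / r ^ n * (V / 2) := by
              rw [hk', hV, mul_pow]; field_simp
          _ ≤ _ := by gcongr
      calc k' * l < k' * (τ * (b x - m)) := by gcongr
        _ ≤ _ := mul_le_mul_of_nonneg_right hkk (hl.le.trans hxl.le)
    refine hsub.trans ?_
    apply weak_level ht hs hVpos hM hk'pos hl _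
      (ne_top_of_le_ne_top hQfin (measure_mono fun y hy => hy.1))
    rw [← hvQ]
    refine le_trans ?_ (hbd.trans (mul_le_mul_right hmor _))
    unfold weakMorreyNorm
    refine le_trans ?_ (le_iSup_of_le c (le_iSup_of_le r (le_iSup_of_le hr le_rfl)))
    gcongr
    exact le_iSup_of_le (k' * l) (le_iSup_of_le hkl le_rfl)
  have hup := one_side 1 (Or.inl rfl) _
    (hQ'm.inter (measurableSet_le hb0 measurable_const)) Set.inter_subset_left
    (fun y hy => by have : b0 y ≤ m := hy.2
                    linarith) hm1
  have hdown := one_side (-1) (Or.inr rfl) _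
    (hQ'm.inter (measurableSet_le measurable_const hb0)) Set.inter_subset_left
    (fun y hy => by have : m ≤ b0 y := hy.2
                    linarith) hm2
  have hQbdd : cube c r ⊆ Metric.closedBall c (n * r) := fun z hz => by
    rw [Metric.mem_closedBall, dist_eq_norm]
    exact norm_le_of_coord _ fun i => by simpa using (hz i).le
  have hQi : IntegrableOn b (cube c r) :=
    (hb.integrableOn_isCompact (isCompact_closedBall c (n * r))).mono_set hQbdd
  have hQmi : IntegrableOn (fun x => b x - m) (cube c r) := hQi.sub (integrableOn_const hQfin)
  have hlayer := layercake_weak (volume.restrict (cube c r)) (fun x => |b x - m|)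
    hQmi.abs.aemeasurable (fun x => abs_nonneg _) hVpos.le hHpos ht
    (by rw [Measure.restrict_apply_univ, hvQ]) (by
      intro l hl
      have hsub : {x | l < |b x - m|} ∩ cube c r ⊆
          {x ∈ cube c r | l < 1 * (b x - m)} ∪ {x ∈ cube c r | l < -1 * (b x - m)} := by
        rintro x ⟨hx, hxQ⟩
        have hx' : l < |b x - m| := hx
        rcases lt_abs.1 hx' with h | h
        · exact Or.inl ⟨hxQ, by linarith⟩
        · exact Or.inr ⟨hxQ, by linarith⟩
      rw [Measure.restrict_apply' hQm]
      refine (measure_mono hsub).trans ((measure_union_le _ _).trans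
        ((add_le_add (hup l hl) (hdown l hl)).trans (le_of_eq ?_)))
      rw [← ENNReal.ofReal_add (by positivity) (by positivity)]
      congr 1; ring)
  have hI : ∫ x in cube c r, |b x - m| ≤ V * H * (1 + 2 / (t - 1)) := by
    rw [integral_eq_lintegral_of_nonneg_ae (Filter.Eventually.of_forall fun x => abs_nonneg _)
      hQmi.abs.aestronglyMeasurable]
    exact ENNReal.toReal_le_of_le_ofReal (by positivity) hlayer
  set a := cubeAvg b c r with ha
  have hVr : volume.real (cube c r) = V := by
    rw [Measure.real, hvQ, ENNReal.toReal_ofReal hVpos.le]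
  have hma : V * |m - a| ≤ ∫ x in cube c r, |b x - m| := by
    have e : V * (a - m) = ∫ x in cube c r, (b x - m) := by
      rw [integral_sub hQi (integrableOn_const hQfin), setIntegral_const, hVr, ha, cubeAvg,
        ← Measure.real, hVr, smul_eq_mul]
      field_simp
    rw [abs_sub_comm, ← abs_of_pos hVpos, ← abs_mul, e]
    exact abs_integral_le_integral_abs
  have hfin : ∫ x in cube c r, |b x - a| ≤ 2 * ∫ x in cube c r, |b x - m| := by
    calc ∫ x in cube c r, |b x - a| ≤ ∫ x in cube c r, (|b x - m| + |m - a|) := by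
          apply integral_mono (hQi.sub (integrableOn_const hQfin)).abs
            (hQmi.abs.add (integrableOn_const hQfin))
          intro x
          exact abs_sub_le _ _ _
      _ = (∫ x in cube c r, |b x - m|) + V * |m - a| := by
          rw [integral_add hQmi.abs (integrableOn_const hQfin), setIntegral_const, hVr, smul_eq_mul]
      _ ≤ _ := by linarith
  have hn0 : (n : ℝ) ≠ 0 := by exact_mod_cast hn.ne'
  have hpow : (2 * r) ^ (n + α) = V * V ^ (α / n) := by
    rw [Real.rpow_add (by positivity), Real.rpow_natCast, hV, ← Real.rpow_natCast (2 * r) n,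
      ← Real.rpow_mul (by positivity), mul_div_cancel₀ _ hn0]
  rw [hpow]
  calc _ ≤ _ := hfin
    _ ≤ 2 * (V * H * (1 + 2 / (t - 1))) := by linarith
    _ = _ := by rw [hH]; ring

/-- If `0 < α < 1`, `1 ≤ q ≤ p < ∞`, `1 < t ≤ s < ∞` with `1/s = 1/p - α/n`,
`1/t = 1/q - α/n`, and `‖[b,T]f‖_{WM^s_t} ≤ M ‖f‖_{M^p_q}` for all bounded measurable `f`
supported in a cube, then `sup_Q |Q|^{-(1+α/n)} ∫_Q |b - b_Q| ≤ C M` with `C` depending only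
on `n, α, p, q, Ω`; consequently `b` agrees a.e. with a function of `Lip_α`-seminorm at most
`C' M`. -/
theorem lip_of_commutator_weak_Morrey_bound (n : ℕ) (α p q s t : ℝ)
    (hα : 0 < α) (hα1 : α < 1) (hq : 1 ≤ q) (hqp : q ≤ p) (ht : 1 < t) (hts : t ≤ s)
    (hs : 1 / s = 1 / p - α / n) (htq : 1 / t = 1 / q - α / n)
    (Ω : En n → ℝ)
    (hΩhom : ∀ l : ℝ, 0 < l → ∀ x : En n, x ≠ 0 → Ω (l • x) = Ω x)
    (hΩsmooth : ContDiffOn ℝ (⊤ : ℕ∞) Ω {(0 : En n)}ᶜ)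
    (hΩne : ∃ x : En n, x ≠ 0 ∧ Ω x ≠ 0)
    (hΩzero : ∫ θ : Metric.sphere (0 : En n) 1, Ω (θ : En n)
        ∂(volume : Measure (En n)).toSphere = 0) :
    ∃ C C' : ℝ, 0 < C ∧ 0 < C' ∧
      ∀ (T : (En n → ℂ) → (En n → ℂ)) (b : En n → ℝ) (M : ℝ),
        LocallyIntegrable b volume →
        (∀ f : En n → ℂ, Integrable f → HasCompactSupport f →
          ∀ᵐ x : En n, x ∉ tsupport f →
            T f x = ∫ y, ((Ω (x - y) / ‖x - y‖ ^ n : ℝ) : ℂ) * f y) →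
        0 ≤ M →
        (∀ f : En n → ℂ, Measurable f → (∃ D : ℝ, ∀ x, ‖f x‖ ≤ D) →
          (∃ (c : En n) (r : ℝ), 0 < r ∧ ∀ x, x ∉ cube c r → f x = 0) →
          weakMorreyNorm s t (fun x => (b x : ℂ) * T f x - T (fun y => (b y : ℂ) * f y) x) ≤
            ENNReal.ofReal M * morreyNorm p q f) →
        lipAvgNorm α b ≤ ENNReal.ofReal (C * M) ∧
        ∃ b' : En n → ℝ, lipSeminorm α b' ≤ ENNReal.ofReal (C' * M) ∧ b =ᵐ[volume] b' := by
  have hn : 0 < n := by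
    rcases Nat.eq_zero_or_pos n with h | h
    · subst h
      obtain ⟨x, hx, -⟩ := hΩne
      exact absurd (Subsingleton.elim x 0) hx
    · exact h
  have hΩc : ContinuousOn Ω {(0 : En n)}ᶜ := hΩsmooth.continuousOn
  obtain ⟨z, k, D, σ, hk, -, hσ, hK⟩ := exists_kernel_data hn Ω hΩhom hΩc hΩne
  obtain ⟨C2, hC2, hcamp⟩ := campanato (n := n) hα
  have ht1 : 0 < t - 1 := by linarith
  set C : ℝ := 2 * (1 + 2 / (t - 1)) / (k * 2 ^ n / 2) with hC
  have hCpos : 0 < C := by positivity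
  refine ⟨C, C2 * C, hCpos, by positivity, ?_⟩
  intro T b M hb hT hM hcomm
  have hosc : ∀ (c : En n) (r : ℝ), 0 < r →
      ∫ x in cube c r, |b x - cubeAvg b c r| ≤ (C * M) * (2 * r) ^ (n + α) := by
    intro c r hr
    have h1 : ∀ M' : ℝ, M < M' →
        ∫ x in cube c r, |b x - cubeAvg b c r| ≤ (C * M') * (2 * r) ^ (n + α) := by
      intro M' hM'
      exact osc_bound hn hq hqp ht hs Ω hΩc z k D σ hk hσ hK T b hb hT M' (hM.trans_lt hM')
        (fun f h1 h2 h3 => (hcomm f h1 h2 h3).trans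
          (mul_le_mul_left (ENNReal.ofReal_le_ofReal hM'.le) _)) c r hr
    have hlim : Filter.Tendsto (fun M' : ℝ => (C * M') * (2 * r) ^ (n + α))
        (nhdsWithin M (Set.Ioi M)) (nhds ((C * M) * (2 * r) ^ (n + α))) := by
      have : Continuous fun M' : ℝ => (C * M') * (2 * r) ^ (n + α) := by fun_prop
      exact this.continuousWithinAt
    exact ge_of_tendsto hlim (Filter.eventually_of_mem self_mem_nhdsWithin fun x hx => h1 x hx)
  refine ⟨?_, ?_⟩
  · unfold lipAvgNorm
    refine iSup_le fun c => iSup_le fun r => iSup_le fun hr => ?_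
    have hQfin : volume (cube c r) ≠ ∞ := by rw [volume_cube c hr]; exact ENNReal.ofReal_ne_top
    have hQbdd : cube c r ⊆ Metric.closedBall c (n * r) := fun z hz => by
      rw [Metric.mem_closedBall, dist_eq_norm]
      exact norm_le_of_coord _ fun i => by simpa using (hz i).le
    have hQi : IntegrableOn b (cube c r) :=
      (hb.integrableOn_isCompact (isCompact_closedBall c (n * r))).mono_set hQbdd
    have hQa : IntegrableOn (fun x => |b x - cubeAvg b c r|) (cube c r) :=
      (hQi.sub (integrableOn_const hQfin)).abs
    have e : ∫⁻ x in cube c r, (‖b x - cubeAvg b c r‖₊ : ℝ≥0∞) =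
        ENNReal.ofReal (∫ x in cube c r, |b x - cubeAvg b c r|) := by
      rw [ofReal_integral_eq_lintegral_ofReal hQa
        (Filter.Eventually.of_forall fun x => abs_nonneg _)]
      simp_rw [← enorm_eq_nnnorm, Real.enorm_eq_ofReal_abs]
    have hV : 0 < (2 * r) ^ n := by positivity
    have hn0 : (n : ℝ) ≠ 0 := by exact_mod_cast hn.ne'
    rw [e, volume_cube c hr, ENNReal.ofReal_rpow_of_pos hV, ← ENNReal.ofReal_mul (by positivity)]
    apply ENNReal.ofReal_le_ofReal
    have hpow : ((2 * r) ^ n) ^ (-(1 + α / (n : ℝ))) * (2 * r) ^ (n + α) = 1 := by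
      rw [← Real.rpow_natCast (2 * r) n, ← Real.rpow_mul (by positivity),
        ← Real.rpow_add (by positivity)]
      have : (n : ℝ) * -(1 + α / n) + (n + α) = 0 := by field_simp; ring
      rw [this, Real.rpow_zero]
    calc _ ≤ ((2 * r) ^ n) ^ (-(1 + α / (n : ℝ))) * ((C * M) * (2 * r) ^ (n + α)) := by
          gcongr
          exact hosc c r hr
      _ = C * M * (((2 * r) ^ n) ^ (-(1 + α / (n : ℝ))) * (2 * r) ^ (n + α)) := by ring
      _ = C * M := by rw [hpow, mul_one]
  · obtain ⟨b', h1, h2⟩ := hcamp (C * M) b (by positivity) hb hosc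
    exact ⟨b', by rwa [mul_assoc], h2⟩
end
end

section
/- Let 0 < α < 1, 1 < q ≤ p < ∞, 1 < l ≤ s < ∞ with 1/s = 1/p − α/n and l/s = q/p. Let K : ℝⁿ \ {0} → ℂ be measurable with |K(z)| ≤ A |z|^{−n} for all z ≠ 0, and let b ∈ Lip_α(ℝⁿ). For f ∈ M^p_q, define the commutator C_b f(x) := ∫_{ℝⁿ} (b(x) − b(y)) K(x−y) f(y) dy (the integral converges absolutely for almost every x). Then ‖C_b f‖_{M^s_l} ≤ C A ‖b‖_{Lip_α} ‖f‖_{M^p_q}, where C depends only on n, α, p, q. -/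
open MeasureTheory ENNReal

noncomputable section

lemma int_Ioi {a d : ℝ} (ha : a < -1) (hd : 0 < d) :
    ∫⁻ t in Set.Ioi d, ENNReal.ofReal (t ^ a) = ENNReal.ofReal (d ^ (a + 1) / (-(a + 1))) := by
  rw [← ofReal_integral_eq_lintegral_ofReal (integrableOn_Ioi_rpow_of_lt ha hd), integral_Ioi_rpow_of_lt ha hd]
  · congr 1
    rw [div_neg, neg_div]
  · filter_upwards [ae_restrict_mem measurableSet_Ioi] with t ht
    exact Real.rpow_nonneg (hd.le.trans (le_of_lt ht)) _

lemma int_Ioc {a R : ℝ} (ha : -1 < a) (hR : 0 ≤ R) :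
    ∫⁻ t in Set.Ioc 0 R, ENNReal.ofReal (t ^ a) = ENNReal.ofReal (R ^ (a + 1) / (a + 1)) := by
  have hi : IntegrableOn (fun t : ℝ => t ^ a) (Set.Ioc 0 R) :=
    (intervalIntegrable_iff_integrableOn_Ioc_of_le hR).1 (intervalIntegral.intervalIntegrable_rpow' ha)
  rw [← ofReal_integral_eq_lintegral_ofReal hi, ← intervalIntegral.integral_of_le hR,
    integral_rpow (Or.inl ha)]
  · rw [Real.zero_rpow (by linarith), sub_zero]
  · filter_upwards [ae_restrict_mem measurableSet_Ioc] with t ht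
    exact Real.rpow_nonneg ht.1.le _

def mm {n : ℕ} (g : (Fin n → ℝ) → ℝ≥0∞) (x : Fin n → ℝ) (t : ℝ) : ℝ≥0∞ :=
  ∫⁻ y in Metric.ball x t, g y

def JJ {n : ℕ} (a : ℝ) (g : (Fin n → ℝ) → ℝ≥0∞) (x : Fin n → ℝ) : ℝ≥0∞ :=
  ∫⁻ t in Set.Ioi (0 : ℝ), ENNReal.ofReal (t ^ a) * mm g x t

lemma mm_eq {n : ℕ} (g : (Fin n → ℝ) → ℝ≥0∞) (x : Fin n → ℝ) (t : ℝ) :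
    mm g x t = ∫⁻ y, {z : ((Fin n → ℝ) × ℝ) × (Fin n → ℝ) | dist z.2 z.1.1 < z.1.2}.indicator
      (fun z => g z.2) ((x, t), y) := by
  unfold mm
  rw [← lintegral_indicator Metric.isOpen_ball.measurableSet]
  rfl

lemma meas_ind {n : ℕ} {g : (Fin n → ℝ) → ℝ≥0∞} (hg : Measurable g) :
    Measurable ({z : ((Fin n → ℝ) × ℝ) × (Fin n → ℝ) | dist z.2 z.1.1 < z.1.2}.indicator
      (fun z => g z.2)) := by
  refine Measurable.indicator (hg.comp measurable_snd) ?_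
  exact measurableSet_lt (by fun_prop) (by fun_prop)

lemma meas_mm {n : ℕ} {g : (Fin n → ℝ) → ℝ≥0∞} (hg : Measurable g) :
    Measurable (fun z : (Fin n → ℝ) × ℝ => mm g z.1 z.2) := by
  simp_rw [mm_eq]
  exact (meas_ind hg).lintegral_prod_right'

lemma meas_mm_left {n : ℕ} {g : (Fin n → ℝ) → ℝ≥0∞} (hg : Measurable g) (t : ℝ) :
    Measurable (fun x => mm g x t) := by
  have h := meas_mm hg
  generalize mm g = M at h ⊢
  exact h.comp (measurable_id.prodMk measurable_const)

lemma meas_mm_right {n : ℕ} {g : (Fin n → ℝ) → ℝ≥0∞} (hg : Measurable g) (x : Fin n → ℝ) :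
    Measurable (fun t => mm g x t) := by
  have h := meas_mm hg
  generalize mm g = M at h ⊢
  exact h.comp (measurable_const.prodMk measurable_id)

lemma meas_near {n : ℕ} {a : ℝ} (S : Set ℝ) {g : (Fin n → ℝ) → ℝ≥0∞} (hg : Measurable g) :
    Measurable (fun x => ∫⁻ t in S, ENNReal.ofReal (t ^ a) * mm g x t) := by
  refine Measurable.lintegral_prod_right' (f := fun z : (Fin n → ℝ) × ℝ => ENNReal.ofReal (z.2 ^ a) * mm g z.1 z.2) ?_
  exact (by fun_prop : Measurable (fun z : (Fin n → ℝ) × ℝ => ENNReal.ofReal (z.2 ^ a))).mul (meas_mm hg)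

lemma int_mm {n : ℕ} {g : (Fin n → ℝ) → ℝ≥0∞} (hg : Measurable g) {t : ℝ} (ht : 0 < t) :
    ∫⁻ x, mm g x t = ENNReal.ofReal ((2 * t) ^ n) * ∫⁻ y, g y := by
  simp_rw [mm_eq]
  rw [lintegral_lintegral_swap]
  · rw [← lintegral_const_mul _ hg]
    refine lintegral_congr fun y => ?_
    have : ∀ x : Fin n → ℝ, {z : ((Fin n → ℝ) × ℝ) × (Fin n → ℝ) | dist z.2 z.1.1 < z.1.2}.indicator
      (fun z => g z.2) ((x, t), y) = (Metric.ball y t).indicator (fun _ => g y) x := by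
      intro x
      simp only [Set.indicator, Set.mem_ofPred_eq, Metric.mem_ball, dist_comm]
    simp_rw [this]
    rw [lintegral_indicator Metric.isOpen_ball.measurableSet, setLIntegral_const, Real.volume_pi_ball _ ht, mul_comm]
    simp
  · exact ((meas_ind hg).comp (by fun_prop : Measurable (fun z : (Fin n → ℝ) × (Fin n → ℝ) => ((z.1, t), z.2)))).aemeasurable

lemma JJ_eq {n : ℕ} {a : ℝ} {g : (Fin n → ℝ) → ℝ≥0∞} (hg : Measurable g) (x : Fin n → ℝ) :
    JJ a g x = ∫⁻ y, (∫⁻ t in Set.Ioi (dist y x), ENNReal.ofReal (t ^ a)) * g y := by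
  unfold JJ
  simp_rw [mm_eq]
  have hGm := meas_ind hg
  have hGe : ∀ t y, {z : ((Fin n → ℝ) × ℝ) × (Fin n → ℝ) | dist z.2 z.1.1 < z.1.2}.indicator
      (fun z => g z.2) ((x, t), y) = if dist y x < t then g y else 0 := by
    intro t y
    simp [Set.indicator]
  generalize {z : ((Fin n → ℝ) × ℝ) × (Fin n → ℝ) | dist z.2 z.1.1 < z.1.2}.indicator
      (fun z => g z.2) = G at hGm hGe ⊢
  have h0 : Measurable (fun z : ℝ × (Fin n → ℝ) => G ((x, z.1), z.2)) := by fun_prop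
  have h1 : ∀ t : ℝ, ENNReal.ofReal (t ^ a) * ∫⁻ y, G ((x, t), y) = ∫⁻ y, ENNReal.ofReal (t ^ a) * G ((x, t), y) := by
    intro t
    rw [lintegral_const_mul]
    fun_prop
  simp_rw [h1]
  rw [lintegral_lintegral_swap (by fun_prop)]
  refine lintegral_congr fun y => ?_
  rw [← lintegral_mul_const _ (by fun_prop), ← lintegral_indicator measurableSet_Ioi,
      ← lintegral_indicator measurableSet_Ioi]
  refine lintegral_congr fun t => ?_
  rw [Set.indicator_apply, Set.indicator_apply, hGe]
  by_cases h : dist y x < t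
  · have : 0 < t := dist_nonneg.trans_lt h
    simp [h, this]
  · simp [h]

lemma far_le {n : ℕ} {a γ D R : ℝ} (hD : 0 < D) (hR : 0 < R) (haγ : a + γ < -1)
    {g : (Fin n → ℝ) → ℝ≥0∞} {x : Fin n → ℝ}
    (hm : ∀ t, 0 < t → mm g x t ≤ ENNReal.ofReal (D * t ^ γ)) :
    ∫⁻ t in Set.Ioi R, ENNReal.ofReal (t ^ a) * mm g x t ≤
      ENNReal.ofReal (D * (R ^ (a + γ + 1) / (-(a + γ + 1)))) := by
  rw [ENNReal.ofReal_mul hD.le, ← int_Ioi haγ hR, ← lintegral_const_mul _ (by fun_prop)]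
  refine setLIntegral_mono (by fun_prop) fun t ht => ?_
  have ht0 : 0 < t := hR.trans ht
  refine (mul_le_mul_right (hm t ht0) _).trans ?_
  rw [← ENNReal.ofReal_mul (by positivity), ← ENNReal.ofReal_mul hD.le, Real.rpow_add ht0]
  apply le_of_eq; congr 1; ring

lemma near_bdd {n : ℕ} {α R μ : ℝ} (hα : 0 < α) (hR : 0 < R) (hμ : 0 ≤ μ)
    {g : (Fin n → ℝ) → ℝ≥0∞} {x : Fin n → ℝ}
    (hm : ∀ y, g y ≤ ENNReal.ofReal μ) :
    ∫⁻ t in Set.Ioc 0 R, ENNReal.ofReal (t ^ (α - n - 1)) * mm g x t ≤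
      ENNReal.ofReal (2 ^ n / α * R ^ α * μ) := by
  have e : 2 ^ n / α * R ^ α * μ = (2 ^ n * μ) * (R ^ ((α - 1) + 1) / ((α - 1) + 1)) := by
    rw [sub_add_cancel]; ring
  rw [e, ENNReal.ofReal_mul (by positivity), ← int_Ioc (by linarith) hR.le, ← lintegral_const_mul _ (by fun_prop)]
  refine setLIntegral_mono (by fun_prop) fun t ht => ?_
  have ht0 : 0 < t := ht.1
  have h1 : mm g x t ≤ ENNReal.ofReal (μ * (2 * t) ^ n) := by
    unfold mm
    refine (lintegral_mono hm).trans ?_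
    rw [setLIntegral_const, Real.volume_pi_ball _ ht0, ← ENNReal.ofReal_mul hμ]
    simp
  refine (mul_le_mul_right h1 _).trans ?_
  rw [← ENNReal.ofReal_mul (by positivity), ← ENNReal.ofReal_mul (by positivity)]
  apply le_of_eq; congr 1
  rw [show α - 1 = (α - n - 1) + n by ring, Real.rpow_add ht0, Real.rpow_natCast]; ring

lemma near_L1 {n : ℕ} {α R : ℝ} (hα : 0 < α) (hR : 0 < R)
    {g : (Fin n → ℝ) → ℝ≥0∞} (hg : Measurable g) :
    ∫⁻ x, ∫⁻ t in Set.Ioc 0 R, ENNReal.ofReal (t ^ (α - n - 1)) * mm g x t ≤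
      ENNReal.ofReal (2 ^ n / α * R ^ α) * ∫⁻ y, g y := by
  rw [lintegral_lintegral_swap]
  · have e : 2 ^ n / α * R ^ α = (2 ^ n) * (R ^ ((α - 1) + 1) / ((α - 1) + 1)) := by
      rw [sub_add_cancel]; ring
    have key : ∀ t : ℝ, 0 < t → ∫⁻ x, mm g x t = ENNReal.ofReal ((2 * t) ^ n) * ∫⁻ y, g y :=
      fun t ht => int_mm hg ht
    generalize ∫⁻ y, g y = G at key ⊢
    rw [e, ENNReal.ofReal_mul (by positivity), ← int_Ioc (by linarith) hR.le, ← lintegral_const_mul _ (by fun_prop),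
      ← lintegral_mul_const _ (by fun_prop)]
    refine setLIntegral_mono (by fun_prop) fun t ht => ?_
    have ht0 : 0 < t := ht.1
    rw [lintegral_const_mul _ (meas_mm_left hg t), key t ht0, ← mul_assoc]
    apply le_of_eq; congr 1
    rw [← ENNReal.ofReal_mul (by positivity), ← ENNReal.ofReal_mul (by positivity)]
    congr 1
    rw [show α - 1 = (α - n - 1) + n by ring, Real.rpow_add ht0, Real.rpow_natCast]; ring
  · exact ((by fun_prop : Measurable (fun z : (Fin n → ℝ) × ℝ => ENNReal.ofReal (z.2 ^ (α - n - 1)))).mul (meas_mm hg)).aemeasurable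

lemma layer {l : ℝ} (hl : 0 < l) (u : ℝ≥0∞) :
    u ^ l ≤ ENNReal.ofReal (3 ^ l * l) * ∫⁻ t in Set.Ioi (0 : ℝ),
      ENNReal.ofReal (t ^ (l - 1)) * (if ENNReal.ofReal (3 * t) < u then 1 else 0) := by
  by_contra hcon
  push Not at hcon
  have h1 := (ENNReal.rpow_lt_rpow_iff (z := 1 / l) (by positivity)).2 hcon
  rw [← ENNReal.rpow_mul, mul_one_div_cancel hl.ne', ENNReal.rpow_one] at h1
  obtain ⟨v, hv1, hv2⟩ := exists_between h1
  have hvt : v ≠ ⊤ := hv2.ne_top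
  have h2 := (ENNReal.rpow_lt_rpow_iff (z := l) hl).2 hv1
  rw [← ENNReal.rpow_mul, one_div_mul_cancel hl.ne', ENNReal.rpow_one] at h2
  refine absurd h2 (not_lt.2 ?_)
  have hv0 : 0 ≤ v.toReal := toReal_nonneg
  have h3 := int_Ioc (a := l - 1) (R := v.toReal / 3) (by linarith) (by positivity)
  have h4 : v ^ l = ENNReal.ofReal (3 ^ l * l) * ENNReal.ofReal ((v.toReal / 3) ^ (l - 1 + 1) / (l - 1 + 1)) := by
    rw [← ENNReal.ofReal_mul (by positivity), sub_add_cancel, Real.div_rpow hv0 (by norm_num)]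
    rw [show 3 ^ l * l * (v.toReal ^ l / 3 ^ l / l) = v.toReal ^ l by field_simp]
    rw [← ENNReal.ofReal_rpow_of_nonneg hv0 hl.le, ofReal_toReal hvt]
  rw [h4, ← h3]
  refine mul_le_mul_right ?_ _
  rw [← lintegral_indicator measurableSet_Ioi, ← lintegral_indicator measurableSet_Ioc]
  refine lintegral_mono fun t => ?_
  by_cases ht : t ∈ Set.Ioc 0 (v.toReal / 3)
  · have hu : ENNReal.ofReal (3 * t) < u := by
      refine lt_of_le_of_lt ?_ hv2
      rw [← ofReal_toReal hvt]
      exact ofReal_le_ofReal (by linarith [ht.2])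
    rw [Set.indicator_of_mem ht, Set.indicator_of_mem (show t ∈ Set.Ioi 0 from ht.1), if_pos hu, mul_one]
  · rw [Set.indicator_of_notMem ht]; exact zero_le

lemma JJ_split {n : ℕ} {a R : ℝ} (hR : 0 < R) (g : (Fin n → ℝ) → ℝ≥0∞) (x : Fin n → ℝ) :
    JJ a g x = (∫⁻ t in Set.Ioc 0 R, ENNReal.ofReal (t ^ a) * mm g x t) +
      ∫⁻ t in Set.Ioi R, ENNReal.ofReal (t ^ a) * mm g x t := by
  unfold JJ
  rw [← Set.Ioc_union_Ioi_eq_Ioi hR.le, lintegral_union measurableSet_Ioi]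
  exact Set.Ioc_disjoint_Ioi le_rfl

lemma level {n : ℕ} {α β D R lam μ : ℝ} (hα : 0 < α) (hβ : 0 < β) (hD : 0 < D) (hR : 0 < R)
    (hlam : 0 < lam) (hμ : 0 < μ) (h1 : D * (R ^ (-β) / β) = lam) (h2 : 2 ^ n / α * R ^ α * μ = lam)
    {h : (Fin n → ℝ) → ℝ≥0∞} (hh : Measurable h)
    (hm : ∀ x t, 0 < t → mm h x t ≤ ENNReal.ofReal (D * t ^ (n - α - β))) :
    volume {x | ENNReal.ofReal (3 * lam) < JJ (α - n - 1) h x} ≤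
      ENNReal.ofReal (1 / μ) * ∫⁻ y, {y | ENNReal.ofReal μ < h y}.indicator h y := by
  have hS : MeasurableSet {y | ENNReal.ofReal μ < h y} := measurableSet_lt measurable_const hh
  set S := {y | ENNReal.ofReal μ < h y} with hSdef
  have hh1 : Measurable (S.indicator h) := hh.indicator hS
  have hh2 : Measurable (Sᶜ.indicator h) := hh.indicator hS.compl
  have hmm : ∀ x t, mm h x t = mm (S.indicator h) x t + mm (Sᶜ.indicator h) x t := by
    intro x t
    unfold mm
    rw [← lintegral_add_left hh1]
    refine lintegral_congr fun y => ?_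
    rw [← Pi.add_apply, Set.indicator_self_add_compl]
  have hsub : {x | ENNReal.ofReal (3 * lam) < JJ (α - n - 1) h x} ⊆
      {x | ENNReal.ofReal lam ≤ ∫⁻ t in Set.Ioc 0 R, ENNReal.ofReal (t ^ (α - n - 1)) * mm (S.indicator h) x t} := by
    intro x hx
    by_contra hcon
    have hcon' : (∫⁻ t in Set.Ioc 0 R, ENNReal.ofReal (t ^ (α - n - 1)) * mm (S.indicator h) x t) < ENNReal.ofReal lam := not_le.1 hcon
    have hx' : ENNReal.ofReal (3 * lam) < JJ (α - n - 1) h x := hx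
    refine absurd hx' (not_lt.2 ?_)
    rw [JJ_split hR]
    have hfar := far_le (a := α - n - 1) (γ := n - α - β) hD hR (by linarith) (hm x)
    rw [show (α - n - 1) + (n - α - β) + 1 = -β by ring, neg_neg, h1] at hfar
    have hnear := near_bdd (n := n) (x := x) (g := Sᶜ.indicator h) hα hR hμ.le (by
      intro y
      by_cases hy : y ∈ S
      · simp [hy]
      · rw [Set.indicator_of_mem (by exact hy)]
        exact not_lt.1 hy)
    rw [h2] at hnear
    have hsp : (∫⁻ t in Set.Ioc 0 R, ENNReal.ofReal (t ^ (α - n - 1)) * mm h x t) =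
        (∫⁻ t in Set.Ioc 0 R, ENNReal.ofReal (t ^ (α - n - 1)) * mm (S.indicator h) x t) +
        ∫⁻ t in Set.Ioc 0 R, ENNReal.ofReal (t ^ (α - n - 1)) * mm (Sᶜ.indicator h) x t := by
      rw [← lintegral_add_left]
      · simp_rw [hmm, mul_add]
      · exact (by fun_prop : Measurable (fun t : ℝ => ENNReal.ofReal (t ^ (α - n - 1)))).mul
          (meas_mm_right hh1 x)
    rw [hsp, show 3 * lam = lam + lam + lam by ring, ENNReal.ofReal_add (by positivity) hlam.le, ENNReal.ofReal_add hlam.le hlam.le]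
    exact add_le_add (add_le_add hcon'.le hnear) hfar
  refine (measure_mono hsub).trans ?_
  refine (meas_ge_le_lintegral_div (meas_near _ hh1).aemeasurable (by simpa using hlam) ofReal_ne_top).trans ?_
  refine (ENNReal.div_le_div_right (near_L1 hα hR hh1) _).trans ?_
  rw [div_eq_mul_inv, mul_right_comm, ← div_eq_mul_inv, ← ENNReal.ofReal_div_of_pos hlam]
  refine mul_le_mul_left (le_of_eq ?_) _
  congr 1
  rw [← h2]
  have := Real.rpow_pos_of_pos hR α
  field_simp

lemma weak_param {n : ℕ} {α β D : ℝ} (hα : 0 < α) (hβ : 0 < β) (hD : 0 < D) :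
    ∃ c3 : ℝ, 0 < c3 ∧ ∀ lam : ℝ, 0 < lam → ∀ h : (Fin n → ℝ) → ℝ≥0∞, Measurable h → 
    (∀ x t, 0 < t → mm h x t ≤ ENNReal.ofReal (D * t ^ (n - α - β))) → 
    volume {x | ENNReal.ofReal (3 * lam) < JJ (α - n - 1) h x} ≤
      ENNReal.ofReal (1 / (c3 * lam ^ (1 + α / β))) *
        ∫⁻ y, {y | ENNReal.ofReal (c3 * lam ^ (1 + α / β)) < h y}.indicator h y := by
  refine ⟨(D / β) ^ (-(α / β)) / (2 ^ n / α), by positivity, fun lam hlam h hh hm => ?_⟩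
  have hc : 0 < D / β := by positivity
  refine level (R := (lam / (D / β)) ^ (-1 / β)) hα hβ hD (by positivity) hlam (by positivity) ?_ ?_ hh hm
  · rw [← Real.rpow_mul (by positivity), show -1 / β * -β = 1 by field_simp, Real.rpow_one]
    field_simp
  · rw [← Real.rpow_mul (by positivity), show -1 / β * α = -(α / β) by ring, Real.rpow_add hlam, Real.rpow_one,
      Real.div_rpow hlam.le hc.le, Real.rpow_neg hlam.le, Real.rpow_neg hc.le]
    have h1 := Real.rpow_pos_of_pos hc (α / β)
    have h2 := Real.rpow_pos_of_pos hlam (α / β)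
    generalize (D / β) ^ (α / β) = X at *
    generalize lam ^ (α / β) = Y at *
    field_simp

lemma inner_int {c3 σ q k : ℝ} (hc : 0 < c3) (hσ : 0 < σ) (hq : 1 < q) (hk : 0 ≤ k) :
    ∫⁻ t in Set.Ioi (0 : ℝ), ENNReal.ofReal (t ^ (σ * q - 1)) * ENNReal.ofReal (1 / (c3 * t ^ σ)) *
      (if c3 * t ^ σ < k then ENNReal.ofReal k else 0) ≤
      ENNReal.ofReal (1 / (c3 ^ q * (σ * (q - 1)))) * ENNReal.ofReal k ^ q := by
  have hσq : 0 < σ * (q - 1) := mul_pos hσ (by linarith)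
  set L := (k / c3) ^ (1 / σ) with hL
  have hL0 : 0 ≤ L := by positivity
  have h3 := int_Ioc (a := σ * (q - 1) - 1) (R := L) (by linarith) hL0
  have : ENNReal.ofReal (1 / (c3 ^ q * (σ * (q - 1)))) * ENNReal.ofReal k ^ q =
     ENNReal.ofReal (k / c3) * ENNReal.ofReal (L ^ (σ * (q - 1) - 1 + 1) / (σ * (q - 1) - 1 + 1)) := by
    rw [sub_add_cancel, hL, ← Real.rpow_mul (by positivity), ENNReal.ofReal_rpow_of_nonneg hk (by linarith),
      ← ENNReal.ofReal_mul (by positivity), ← ENNReal.ofReal_mul (by positivity)]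
    congr 1
    rw [show 1 / σ * (σ * (q - 1)) = q - 1 by field_simp]
    rcases hk.eq_or_lt with rfl | hk
    · simp [Real.zero_rpow (by linarith : q ≠ 0)]
    · rw [Real.rpow_sub (by positivity), Real.rpow_one, Real.div_rpow hk.le hc.le]
      field_simp
  rw [this, ← h3, ← lintegral_const_mul _ (by fun_prop), ← lintegral_indicator measurableSet_Ioi, ← lintegral_indicator measurableSet_Ioc]
  refine lintegral_mono fun t => ?_
  by_cases ht : t ∈ Set.Ioi 0
  · have ht0 : 0 < t := ht
    rw [Set.indicator_of_mem ht]
    split_ifs with hk1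
    · have htL : t ≤ L := by
        rw [hL, one_div]
        refine ((Real.lt_rpow_inv_iff_of_pos ht0.le (by positivity) hσ).2 ?_).le
        rw [lt_div_iff₀ hc]; linarith
      rw [Set.indicator_of_mem (show t ∈ Set.Ioc 0 L from ⟨ht0, htL⟩)]
      rw [← ENNReal.ofReal_mul (by positivity), ← ENNReal.ofReal_mul (by positivity), ← ENNReal.ofReal_mul (by positivity)]
      apply le_of_eq; congr 1
      rw [show σ * q - 1 = (σ * (q - 1) - 1) + σ by ring, Real.rpow_add ht0]
      have := Real.rpow_pos_of_pos ht0 σ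
      field_simp
    · simp
  · rw [Set.indicator_of_notMem ht]; exact zero_le

lemma global {n : ℕ} {α β D q : ℝ} (hα : 0 < α) (hβ : 0 < β) (hD : 0 < D) (hq : 1 < q) :
    ∃ C : ℝ, 0 < C ∧ ∀ h : (Fin n → ℝ) → ℝ≥0∞, Measurable h → (∀ y, h y ≠ ⊤) →
    (∀ x t, 0 < t → mm h x t ≤ ENNReal.ofReal (D * t ^ (n - α - β))) → 
    ∫⁻ x, JJ (α - n - 1) h x ^ ((1 + α / β) * q) ≤ ENNReal.ofReal C * ∫⁻ y, h y ^ q := by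
  obtain ⟨c3, hc3, H⟩ := weak_param (n := n) hα hβ hD
  set σ := 1 + α / β with hσd
  have hσ : 0 < σ := by positivity
  have hl : 0 < σ * q := by positivity
  have hσq : 0 < σ * (q - 1) := mul_pos hσ (by linarith)
  refine ⟨3 ^ (σ * q) * (σ * q) * (1 / (c3 ^ q * (σ * (q - 1)))), by positivity, fun h hh hfin hm => ?_⟩
  have hJ : Measurable (JJ (α - n - 1) h) := meas_near _ hh
  have hmeas1 : Measurable (fun z : (Fin n → ℝ) × ℝ => ENNReal.ofReal (z.2 ^ (σ * q - 1)) *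
      (if ENNReal.ofReal (3 * z.2) < JJ (α - n - 1) h z.1 then (1 : ℝ≥0∞) else 0)) := by
    refine Measurable.mul (by fun_prop) ?_
    exact Measurable.ite (measurableSet_lt (by fun_prop) (by fun_prop)) measurable_const measurable_const
  have hmeas2 : Measurable (fun z : ℝ × (Fin n → ℝ) => ENNReal.ofReal (z.1 ^ (σ * q - 1)) * ENNReal.ofReal (1 / (c3 * z.1 ^ σ)) *
      (if c3 * z.1 ^ σ < (h z.2).toReal then ENNReal.ofReal (h z.2).toReal else 0)) := by
    refine Measurable.mul (by fun_prop) ?_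
    exact Measurable.ite (measurableSet_lt (by fun_prop) (by fun_prop)) (by fun_prop) measurable_const
  calc ∫⁻ x, JJ (α - n - 1) h x ^ (σ * q) 
      ≤ ∫⁻ x, ENNReal.ofReal (3 ^ (σ * q) * (σ * q)) * ∫⁻ t in Set.Ioi (0 : ℝ),
      ENNReal.ofReal (t ^ (σ * q - 1)) * (if ENNReal.ofReal (3 * t) < JJ (α - n - 1) h x then 1 else 0) :=
        lintegral_mono fun x => layer hl _
    _ = ENNReal.ofReal (3 ^ (σ * q) * (σ * q)) * ∫⁻ t in Set.Ioi (0 : ℝ), ∫⁻ x, 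
      ENNReal.ofReal (t ^ (σ * q - 1)) * (if ENNReal.ofReal (3 * t) < JJ (α - n - 1) h x then 1 else 0) := by
        rw [lintegral_const_mul _ hmeas1.lintegral_prod_right', lintegral_lintegral_swap hmeas1.aemeasurable]
    _ ≤ ENNReal.ofReal (3 ^ (σ * q) * (σ * q)) * ∫⁻ t in Set.Ioi (0 : ℝ), ∫⁻ y, 
         ENNReal.ofReal (t ^ (σ * q - 1)) * ENNReal.ofReal (1 / (c3 * t ^ σ)) *
      (if c3 * t ^ σ < (h y).toReal then ENNReal.ofReal (h y).toReal else 0) := by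
        refine mul_le_mul_right ?_ _
        refine setLIntegral_mono hmeas2.lintegral_prod_right' fun t ht => ?_
        have ht0 : 0 < t := ht
        have hms : MeasurableSet {x | ENNReal.ofReal (3 * t) < JJ (α - n - 1) h x} := measurableSet_lt measurable_const hJ
        have e1 : ∫⁻ x, ENNReal.ofReal (t ^ (σ * q - 1)) * (if ENNReal.ofReal (3 * t) < JJ (α - n - 1) h x then 1 else 0)
            = ENNReal.ofReal (t ^ (σ * q - 1)) * volume {x | ENNReal.ofReal (3 * t) < JJ (α - n - 1) h x} := by
          rw [lintegral_const_mul _ (Measurable.ite hms measurable_const measurable_const), ← lintegral_indicator_one hms]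
          congr 1
          refine lintegral_congr fun x => ?_
          simp [Set.indicator_apply]
        rw [e1]
        refine (mul_le_mul_right (H t ht0 h hh hm) _).trans ?_
        rw [← mul_assoc, ← lintegral_const_mul _ (hh.indicator (measurableSet_lt measurable_const hh))]
        refine lintegral_mono fun y => ?_
        refine mul_le_mul_right (le_of_eq ?_) _
        rw [Set.indicator_apply, ofReal_toReal (hfin y)]
        have : (y ∈ {y | ENNReal.ofReal (c3 * t ^ σ) < h y}) ↔ c3 * t ^ σ < (h y).toReal :=
          ENNReal.ofReal_lt_iff_lt_toReal (by positivity) (hfin y)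
        simp only [this]
    _ = ENNReal.ofReal (3 ^ (σ * q) * (σ * q)) * ∫⁻ y, ∫⁻ t in Set.Ioi (0 : ℝ), 
         ENNReal.ofReal (t ^ (σ * q - 1)) * ENNReal.ofReal (1 / (c3 * t ^ σ)) *
      (if c3 * t ^ σ < (h y).toReal then ENNReal.ofReal (h y).toReal else 0) := by
        rw [lintegral_lintegral_swap hmeas2.aemeasurable]
    _ ≤ ENNReal.ofReal (3 ^ (σ * q) * (σ * q)) * ∫⁻ y, ENNReal.ofReal (1 / (c3 ^ q * (σ * (q - 1)))) * ENNReal.ofReal (h y).toReal ^ q := by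
        refine mul_le_mul_right (lintegral_mono fun y => inner_int hc3 hσ hq toReal_nonneg) _
    _ = _ := by
        rw [lintegral_const_mul _ (by fun_prop), ← mul_assoc, ← ENNReal.ofReal_mul (by positivity)]
        simp_rw [ofReal_toReal (hfin _)]

lemma vol_rpow {n : ℕ} (c : Fin n → ℝ) {r : ℝ} (hr : 0 < r) (e : ℝ) :
    volume (Metric.ball c r) ^ e = ENNReal.ofReal ((2 * r) ^ (n * e)) := by
  rw [Real.volume_pi_ball _ hr, ENNReal.ofReal_rpow_of_pos (by positivity), Fintype.card_fin,
    ← Real.rpow_natCast, ← Real.rpow_mul (by positivity)]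

lemma morrey_int {n : ℕ} {p q : ℝ} {g : (Fin n → ℝ) → ℝ≥0∞}
    {c : Fin n → ℝ} {r : ℝ} (hr : 0 < r)
    (H : volume (Metric.ball c r) ^ (1 / p - 1 / q) * (∫⁻ y in Metric.ball c r, g y ^ q) ^ (1 / q) ≤ 1) :
    (∫⁻ y in Metric.ball c r, g y ^ q) ^ (1 / q) ≤ ENNReal.ofReal ((2 * r) ^ (n * (1 / q - 1 / p))) := by
  rw [vol_rpow c hr] at H
  have hpos : 0 < (2 * r) ^ (n * (1 / p - 1 / q)) := by positivity
  rw [mul_comm, ← ENNReal.le_div_iff_mul_le (by left; simpa using hpos) (by left; simp)] at H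
  refine H.trans (le_of_eq ?_)
  rw [one_div, ← ENNReal.ofReal_inv_of_pos hpos, ← Real.rpow_neg (by positivity)]
  congr 2; ring

lemma morrey_mm {n : ℕ} {p q : ℝ} (hq : 1 < q) {g : (Fin n → ℝ) → ℝ≥0∞} (hg : Measurable g)
    {c : Fin n → ℝ} {r : ℝ} (hr : 0 < r)
    (H : volume (Metric.ball c r) ^ (1 / p - 1 / q) * (∫⁻ y in Metric.ball c r, g y ^ q) ^ (1 / q) ≤ 1) :
    mm g c r ≤ ENNReal.ofReal (2 ^ (n - n / p : ℝ) * r ^ (n - n / p : ℝ)) := by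
  have hc : q.HolderConjugate (q / (q - 1)) := Real.HolderConjugate.conjExponent hq
  have h1 := ENNReal.lintegral_mul_le_Lp_mul_Lq (volume.restrict (Metric.ball c r)) hc hg.aemeasurable
    (g := fun _ => 1) aemeasurable_const
  simp only [Pi.mul_apply, mul_one, ENNReal.one_rpow, lintegral_const, one_mul, Measure.restrict_apply_univ] at h1
  refine h1.trans ?_
  refine (mul_le_mul_left (morrey_int hr H) _).trans ?_
  rw [vol_rpow c hr, ← ENNReal.ofReal_mul (by positivity), ← Real.rpow_add (by positivity), ← Real.mul_rpow (by norm_num) hr.le]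
  apply le_of_eq
  congr 2
  have : q ≠ 0 := by linarith
  have : q - 1 ≠ 0 := by linarith
  rw [one_div_div]
  field_simp
  ring

lemma local_morrey {n : ℕ} {α p q s l : ℝ} (hn : 0 < n) (hα : 0 < α) (hq : 1 < q) (hp : 0 < p) (hl : 1 < l)
    (hs0 : 0 < s)
    (hs : 1 / s = 1 / p - α / n) (hlsqp : l / s = q / p) :
    ∃ C : ℝ, 0 < C ∧ ∀ g : (Fin n → ℝ) → ℝ≥0∞, Measurable g → (∀ y, g y ≠ ⊤) →
      (∀ c r, 0 < r → volume (Metric.ball c r) ^ (1 / p - 1 / q) * (∫⁻ y in Metric.ball c r, g y ^ q) ^ (1 / q) ≤ 1) →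
      ∀ c r, 0 < r → volume (Metric.ball c r) ^ (1 / s - 1 / l) *
        (∫⁻ y in Metric.ball c r, JJ (α - n - 1) g y ^ l) ^ (1 / l) ≤ ENNReal.ofReal C := by
  have hn' : (0 : ℝ) < n := by exact_mod_cast hn
  set β : ℝ := n / s with hβd
  have hβ : 0 < β := by positivity
  have hβ' : β = n / p - α := by
    have : β = n * (1 / s) := by rw [hβd]; ring
    rw [this, hs]; field_simp
  have hσl : (1 + α / β) * q = l := by
    have h1 : α = n / p - β := by linarith
    have h2 : 1 + α / β = s / p := by
      rw [h1, hβd]; field_simp; ring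
    rw [h2]; field_simp at hlsqp ⊢; linarith
  set D : ℝ := 2 ^ (n - n / p : ℝ) with hDd
  have hD : 0 < D := by positivity
  obtain ⟨C0, hC0, G⟩ := global (n := n) hα hβ hD hq
  rw [hσl] at G
  have hl0 : 0 < l := by linarith
  refine ⟨(2 ^ (n * (l / s - 1)) * (2 ^ (l - 1) * (C0 * 4 ^ (n * (1 - q / p)) + (D / β) ^ l * 2 ^ (n : ℝ)))) ^ (1 / l), by positivity, fun g hg hfin H c r hr => ?_⟩
  have hmg : ∀ x t, 0 < t → mm g x t ≤ ENNReal.ofReal (D * t ^ (n - α - β)) := by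
    intro x t ht
    rw [show n - α - β = n - n / p by rw [hβ']; ring]
    exact morrey_mm hq hg ht (H x t ht)
  set h := (Metric.ball c (2 * r)).indicator g with hhd
  have hB : MeasurableSet (Metric.ball c (2 * r)) := Metric.isOpen_ball.measurableSet
  have hh : Measurable h := hg.indicator hB
  have hle : ∀ y, h y ≤ g y := fun y => Set.indicator_le_self' (fun _ _ => zero_le) y
  have hG := G h hh (fun y => ne_top_of_le_ne_top (hfin y) (hle y))
    (fun x t ht => (lintegral_mono hle).trans (hmg x t ht))
  have hq0 : 0 < q := by linarith
  have hhq : ∫⁻ y, h y ^ q ≤ ENNReal.ofReal ((4 * r) ^ (n * (1 - q / p))) := by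
    have e : ∫⁻ y, h y ^ q = ∫⁻ y in Metric.ball c (2 * r), g y ^ q := by
      rw [← lintegral_indicator hB]
      refine lintegral_congr fun y => ?_
      by_cases hy : y ∈ Metric.ball c (2 * r)
      · rw [hhd, Set.indicator_of_mem hy, Set.indicator_of_mem hy]
      · rw [hhd, Set.indicator_of_notMem hy, Set.indicator_of_notMem hy, ENNReal.zero_rpow_of_pos hq0]
    have h1 := morrey_int (by positivity) (H c (2 * r) (by positivity))
    rw [← e] at h1
    have h2 := ENNReal.rpow_le_rpow h1 hq0.le
    rw [← ENNReal.rpow_mul, one_div_mul_cancel hq0.ne', ENNReal.rpow_one,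
      ENNReal.ofReal_rpow_of_pos (by positivity), ← Real.rpow_mul (by positivity)] at h2
    refine h2.trans (le_of_eq ?_)
    congr 2
    · ring
    · field_simp
  have hpt : ∀ x ∈ Metric.ball c r, JJ (α - n - 1) g x ≤ JJ (α - n - 1) h x + ENNReal.ofReal (D / β * r ^ (-β)) := by
    intro x hx
    rw [JJ_split hr g x]
    refine add_le_add ?_ ?_
    · rw [JJ_split hr h x]
      refine le_trans (le_of_eq ?_) le_self_add
      refine setLIntegral_congr_fun measurableSet_Ioc fun t ht => ?_
      congr 1
      unfold mm
      refine setLIntegral_congr_fun Metric.isOpen_ball.measurableSet fun y hy => ?_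
      rw [hhd, Set.indicator_of_mem]
      rw [Metric.mem_ball] at hx hy ⊢
      linarith [dist_triangle y x c, ht.2]
    · have hfar := far_le (a := α - n - 1) (γ := n - α - β) hD hr (by linarith) (hmg x)
      rw [show (α - n - 1) + (n - α - β) + 1 = -β by ring, neg_neg] at hfar
      refine hfar.trans (le_of_eq ?_)
      congr 1; ring
  have hJh : Measurable (JJ (α - n - 1) h) := meas_near _ hh
  have hint : ∫⁻ y in Metric.ball c r, JJ (α - n - 1) g y ^ l ≤
      ENNReal.ofReal (2 ^ (l - 1) * (C0 * 4 ^ (n * (1 - q / p)) + (D / β) ^ l * 2 ^ (n : ℝ)) * r ^ (n * (1 - q / p))) := by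
    calc ∫⁻ y in Metric.ball c r, JJ (α - n - 1) g y ^ l 
        ≤ ∫⁻ y in Metric.ball c r, 2 ^ (l - 1) * (JJ (α - n - 1) h y ^ l + ENNReal.ofReal (D / β * r ^ (-β)) ^ l) := by
          refine setLIntegral_mono (by fun_prop) fun x hx => ?_
          exact (ENNReal.rpow_le_rpow (hpt x hx) hl0.le).trans (ENNReal.rpow_add_le_mul_rpow_add_rpow _ _ hl.le)
      _ = 2 ^ (l - 1) * ((∫⁻ y in Metric.ball c r, JJ (α - n - 1) h y ^ l) + ENNReal.ofReal (D / β * r ^ (-β)) ^ l * volume (Metric.ball c r)) := by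
          rw [lintegral_const_mul _ (by fun_prop), lintegral_add_right _ measurable_const, setLIntegral_const]
      _ ≤ 2 ^ (l - 1) * (ENNReal.ofReal C0 * ENNReal.ofReal ((4 * r) ^ (n * (1 - q / p))) + ENNReal.ofReal (D / β * r ^ (-β)) ^ l * volume (Metric.ball c r)) := by
          gcongr
          exact (setLIntegral_le_lintegral _ _).trans (hG.trans (by gcongr))
      _ = _ := by
          have e2 : (2 : ℝ≥0∞) ^ (l - 1) = ENNReal.ofReal (2 ^ (l - 1)) := by
            rw [← ENNReal.ofReal_rpow_of_pos (by norm_num)]; simp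
          have e3 := vol_rpow c hr 1
          rw [ENNReal.rpow_one, mul_one] at e3
          rw [e2, e3, ENNReal.ofReal_rpow_of_pos (by positivity), ← ENNReal.ofReal_mul (by positivity), ← ENNReal.ofReal_mul (by positivity),
            ← ENNReal.ofReal_add (by positivity) (by positivity), ← ENNReal.ofReal_mul (by positivity)]
          congr 1
          rw [Real.mul_rpow (by positivity) (by positivity), Real.mul_rpow (by positivity) (by positivity), Real.mul_rpow (by positivity) (by positivity),
            ← Real.rpow_mul hr.le]
          have e4 : r ^ (-β * l) * r ^ (n : ℝ) = r ^ (n * (1 - q / p)) := by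
            rw [← Real.rpow_add hr]
            congr 1
            rw [← hlsqp, hβd]; ring
          rw [← e4]; ring
  rw [vol_rpow c hr]
  refine (mul_le_mul_right (ENNReal.rpow_le_rpow hint (by positivity)) _).trans (le_of_eq ?_)
  rw [ENNReal.ofReal_rpow_of_pos (by positivity), ← ENNReal.ofReal_mul (by positivity)]
  congr 1
  have e5 : (2 * r) ^ (n * (1 / s - 1 / l)) = ((2 * r) ^ (n * (l / s - 1))) ^ (1 / l) := by
    rw [← Real.rpow_mul (by positivity)]
    congr 1; field_simp
  rw [e5, ← Real.mul_rpow (by positivity) (by positivity), Real.mul_rpow (by positivity) hr.le]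
  congr 1
  have e6 : r ^ (n * (l / s - 1)) * r ^ (n * (1 - q / p)) = 1 := by
    rw [← Real.rpow_add hr, hlsqp, show (n * (q / p - 1) + n * (1 - q / p) : ℝ) = 0 by ring, Real.rpow_zero]
  linear_combination (2 ^ (n * (l / s - 1)) * (2 ^ (l - 1) * (C0 * 4 ^ (n * (1 - q / p)) + (D / β) ^ l * 2 ^ (n : ℝ)))) * e6

lemma mm_smul {n : ℕ} (t : ℝ≥0∞) {g : (Fin n → ℝ) → ℝ≥0∞} (hg : Measurable g) (x : Fin n → ℝ) (r : ℝ) :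
    mm (fun y => t * g y) x r = t * mm g x r := by
  unfold mm
  rw [lintegral_const_mul _ hg]

lemma JJ_smul {n : ℕ} {a : ℝ} (t : ℝ≥0∞) {g : (Fin n → ℝ) → ℝ≥0∞} (hg : Measurable g) (x : Fin n → ℝ) :
    JJ a (fun y => t * g y) x = t * JJ a g x := by
  unfold JJ
  have hm := meas_mm_right hg x
  simp_rw [mm_smul t hg]
  rw [← lintegral_const_mul _ (by fun_prop)]
  refine lintegral_congr fun r => ?_
  ring

lemma int_smul {X : Type*} [MeasurableSpace X] (ν : Measure X) {q : ℝ} (hq : 0 < q) (t : ℝ≥0∞) {u : X → ℝ≥0∞} (hu : Measurable u) :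
    (∫⁻ y, (t * u y) ^ q ∂ν) ^ (1 / q) = t * (∫⁻ y, u y ^ q ∂ν) ^ (1 / q) := by
  simp_rw [ENNReal.mul_rpow_of_nonneg _ _ hq.le]
  rw [lintegral_const_mul _ (by fun_prop), ENNReal.mul_rpow_of_nonneg _ _ (by positivity), ← ENNReal.rpow_mul,
    mul_one_div_cancel hq.ne', ENNReal.rpow_one]

lemma scaled_morrey {n : ℕ} {α p q s l : ℝ} (hn : 0 < n) (hα : 0 < α) (hq : 1 < q) (hp : 0 < p) (hl : 1 < l)
    (hs0 : 0 < s)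
    (hs : 1 / s = 1 / p - α / n) (hlsqp : l / s = q / p) :
    ∃ C : ℝ, 0 < C ∧ ∀ g : (Fin n → ℝ) → ℝ≥0∞, Measurable g → (∀ y, g y ≠ ⊤) → ∀ F : ℝ≥0∞, F ≠ ⊤ →
      (∀ c r, 0 < r → volume (Metric.ball c r) ^ (1 / p - 1 / q) * (∫⁻ y in Metric.ball c r, g y ^ q) ^ (1 / q) ≤ F) →
      ∀ c r, 0 < r → volume (Metric.ball c r) ^ (1 / s - 1 / l) *
        (∫⁻ y in Metric.ball c r, JJ (α - n - 1) g y ^ l) ^ (1 / l) ≤ ENNReal.ofReal C * F := by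
  obtain ⟨C, hC, H⟩ := local_morrey hn hα hq hp hl hs0 hs hlsqp
  refine ⟨C, hC, fun g hg hfin F hF hb c r hr => ?_⟩
  have hJ : Measurable (JJ (α - n - 1) g) := meas_near _ hg
  have key : ∀ M : ℝ≥0∞, M ≠ 0 → M ≠ ⊤ → F ≤ M → volume (Metric.ball c r) ^ (1 / s - 1 / l) *
        (∫⁻ y in Metric.ball c r, JJ (α - n - 1) g y ^ l) ^ (1 / l) ≤ ENNReal.ofReal C * M := by
    intro M hM0 hMt hFM
    have h1 := H (fun y => M⁻¹ * g y) (hg.const_mul _) (fun y => ENNReal.mul_ne_top (by simpa using hM0) (hfin y)) (by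
      intro c r hr
      rw [int_smul _ (by linarith) _ hg, mul_left_comm]
      refine (mul_le_mul_right ((hb c r hr).trans hFM) _).trans ?_
      rw [ENNReal.inv_mul_cancel hM0 hMt]) c r hr
    simp_rw [JJ_smul _ hg] at h1
    rw [int_smul _ (by linarith) _ hJ, mul_left_comm] at h1
    rw [mul_comm M⁻¹, ← div_eq_mul_inv, ENNReal.div_le_iff hM0 hMt] at h1
    exact h1
  refine ENNReal.le_of_forall_pos_le_add fun ε hε _ => ?_
  have hC' : ENNReal.ofReal C ≠ 0 := by simpa using hC
  have hε' : (ε : ℝ≥0∞) / ENNReal.ofReal C ≠ ⊤ := ENNReal.div_ne_top (by simp) hC'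
  have hε0 : (ε : ℝ≥0∞) / ENNReal.ofReal C ≠ 0 := by
    simp [hε.ne']
  have h2 := key (F + ε / ENNReal.ofReal C) (by simp [hε.ne']) (by simp [hF, hε']) le_self_add
  rwa [mul_add, ENNReal.mul_div_cancel hC' (by simp)] at h2

lemma JJ_ae_lt_top {n : ℕ} {a l e : ℝ} (hl : 0 < l) {g : (Fin n → ℝ) → ℝ≥0∞} (hg : Measurable g) {M : ℝ≥0∞} (hM : M ≠ ⊤)
    (h : ∀ c r, 0 < r → volume (Metric.ball c r) ^ e *
        (∫⁻ y in Metric.ball c r, JJ a g y ^ l) ^ (1 / l) ≤ M) : ∀ᵐ x, JJ a g x < ⊤ := by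
  have hJ : Measurable (JJ a g) := meas_near _ hg
  have h1 : ∀ N : ℕ, ∀ᵐ x ∂volume.restrict (Metric.ball (0 : Fin n → ℝ) (N + 1)), JJ a g x < ⊤ := by
    intro N
    have hr : (0 : ℝ) < N + 1 := by positivity
    have h2 := h 0 (N + 1) hr
    rw [vol_rpow _ hr] at h2
    have h3 : (∫⁻ y in Metric.ball (0 : Fin n → ℝ) (N + 1), JJ a g y ^ l) ≠ ⊤ := by
      intro h4
      rw [h4, ENNReal.top_rpow_of_pos (by positivity), ENNReal.mul_top] at h2
      · exact hM (top_le_iff.1 h2)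
      · have : 0 < (2 * ((N : ℝ) + 1)) ^ (n * e) := by positivity
        simpa using this
    filter_upwards [ae_lt_top (by fun_prop) h3] with x hx
    by_contra hc
    rw [not_lt, top_le_iff] at hc
    rw [hc, ENNReal.top_rpow_of_pos hl] at hx
    exact lt_irrefl _ hx
  have h2 := (ae_restrict_iUnion_iff (fun N : ℕ => Metric.ball (0 : Fin n → ℝ) (N + 1)) (fun x => JJ a g x < ⊤)).2 h1
  have h3 : (⋃ N : ℕ, Metric.ball (0 : Fin n → ℝ) (N + 1)) = Set.univ := by
    rw [Set.eq_univ_iff_forall]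
    intro x
    obtain ⟨N, hN⟩ := exists_nat_gt (dist x 0)
    exact Set.mem_iUnion.2 ⟨N, by rw [Metric.mem_ball]; linarith⟩
  rwa [h3, Measure.restrict_univ] at h2

lemma cube_eq {n : ℕ} (c : En n) {r : ℝ} (hr : 0 < r) :
    cube c r = (WithLp.ofLp : En n → (Fin n → ℝ)) ⁻¹' (Metric.ball (WithLp.ofLp c) r) := by
  ext y
  simp only [cube, Set.mem_preimage, Metric.mem_ball, dist_pi_lt_iff hr, Real.dist_eq]
  rfl

lemma vol_cube {n : ℕ} (c : En n) {r : ℝ} (hr : 0 < r) :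
    volume (cube c r) = volume (Metric.ball (WithLp.ofLp c) r) := by
  rw [cube_eq c hr]
  exact (PiLp.volume_preserving_ofLp (Fin n)).measure_preimage Metric.isOpen_ball.measurableSet.nullMeasurableSet

lemma int_cube {n : ℕ} (c : En n) {r : ℝ} (hr : 0 < r) {F : (Fin n → ℝ) → ℝ≥0∞} (hF : Measurable F) :
    ∫⁻ y in cube c r, F (WithLp.ofLp y) = ∫⁻ y in Metric.ball (WithLp.ofLp c) r, F y := by
  rw [cube_eq c hr]
  exact (PiLp.volume_preserving_ofLp (Fin n)).setLIntegral_comp_preimage Metric.isOpen_ball.measurableSet hF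

lemma lip_le {n : ℕ} {α : ℝ} (b : En n → ℝ) {x y : En n} (h : x ≠ y) :
    ‖b x - b y‖ₑ ≤ lipSeminorm α b * edist x y ^ α := by
  have h1 : ‖b x - b y‖ₑ / edist x y ^ α ≤ lipSeminorm α b :=
    le_iSup_of_le x (le_iSup_of_le y (le_iSup_of_le h le_rfl))
  have h0 : edist x y ≠ 0 := by simpa [edist_eq_zero] using h
  rwa [ENNReal.div_le_iff] at h1
  · exact fun h2 => by
      rcases ENNReal.rpow_eq_zero_iff.1 h2 with h3 | h3
      · exact h0 h3.1
      · exact edist_ne_top _ _ h3.1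
  · exact ENNReal.rpow_ne_top_of_ne_zero h0 (edist_ne_top _ _)

lemma lip_cont {n : ℕ} {α : ℝ} (hα : 0 < α) {b : En n → ℝ} (h : lipSeminorm α b < ⊤) : Continuous b := by
  have : HolderWith (lipSeminorm α b).toNNReal ⟨α, hα.le⟩ b := by
    intro x y
    by_cases hxy : x = y
    · simp [hxy]
    · rw [ENNReal.coe_toNNReal h.ne, edist_eq_enorm_sub]
      exact lip_le b hxy
  exact this.continuous (by exact_mod_cast hα)

lemma kernel_bound {n : ℕ} {α A : ℝ} (hn : 0 < n) (hα : 0 < α) (hα1 : α < 1) {K : En n → ℂ}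
    (hA : 0 ≤ A)
    (hK : ∀ z : En n, z ≠ 0 → ‖K z‖ ≤ A * ‖z‖ ^ (-(n : ℝ))) (b : En n → ℝ) (x y : En n) :
    ‖((b x - b y : ℝ) : ℂ) * K (x - y)‖ₑ ≤ ENNReal.ofReal A * lipSeminorm α b * ENNReal.ofReal (n - α) *
      ∫⁻ t in Set.Ioi (dist (WithLp.ofLp y) (WithLp.ofLp x)), ENNReal.ofReal (t ^ (α - n - 1)) := by
  by_cases hxy : x = y
  · simp [hxy]
  have hn1 : (1 : ℝ) ≤ n := by exact_mod_cast hn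
  set d := dist (WithLp.ofLp y) (WithLp.ofLp x) with hd
  have hd0 : 0 < d := by
    rw [hd, dist_pos]
    intro h
    exact hxy (WithLp.ofLp_injective 2 h).symm
  have hdρ : d ≤ dist x y := by
    rw [hd, dist_pi_le_iff dist_nonneg]
    intro i
    rw [dist_comm x y, dist_eq_norm, dist_eq_norm]
    exact PiLp.norm_apply_le (y - x) i
  have hρ : 0 < dist x y := hd0.trans_le hdρ
  rw [int_Ioi (by linarith) hd0, enorm_mul, mul_assoc (ENNReal.ofReal A * lipSeminorm α b), ← ENNReal.ofReal_mul (by linarith),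
    show (n - α) * (d ^ (α - n - 1 + 1) / -(α - n - 1 + 1)) = d ^ (α - n) by
      rw [sub_add_cancel]
      have : (n : ℝ) - α ≠ 0 := by linarith
      rw [neg_sub]
      field_simp]
  have h1 : ‖((b x - b y : ℝ) : ℂ)‖ₑ ≤ lipSeminorm α b * ENNReal.ofReal (dist x y ^ α) := by
    rw [← ENNReal.ofReal_rpow_of_pos hρ, ← edist_dist]
    refine le_trans (le_of_eq ?_) (lip_le b hxy)
    rw [← ofReal_norm_eq_enorm, ← ofReal_norm_eq_enorm, Complex.norm_real]
  have h2 : ‖K (x - y)‖ₑ ≤ ENNReal.ofReal A * ENNReal.ofReal (dist x y ^ (-(n : ℝ))) := by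
    rw [← ofReal_norm_eq_enorm, ← ENNReal.ofReal_mul hA, dist_eq_norm]
    exact ENNReal.ofReal_le_ofReal (hK _ (sub_ne_zero.2 hxy))
  refine (mul_le_mul' h1 h2).trans ?_
  have h3 : ENNReal.ofReal (dist x y ^ α) * ENNReal.ofReal (dist x y ^ (-(n : ℝ))) ≤ ENNReal.ofReal (d ^ (α - n)) := by
    rw [← ENNReal.ofReal_mul (by positivity), ← Real.rpow_add hρ]
    refine ENNReal.ofReal_le_ofReal ?_
    exact Real.rpow_le_rpow_of_nonpos hd0 hdρ (by linarith)
  calc _ = ENNReal.ofReal A * lipSeminorm α b * (ENNReal.ofReal (dist x y ^ α) * ENNReal.ofReal (dist x y ^ (-(n : ℝ)))) := by ring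
    _ ≤ _ := mul_le_mul_right h3 _

/-- For `0 < α < 1`, `1 < q ≤ p < ∞`, `1 < l ≤ s < ∞` with `1/s = 1/p - α/n`
and `l/s = q/p`, a kernel with `|K z| ≤ A |z|^{-n}` and `b ∈ Lip_α`, the commutator
`C_b f(x) = ∫ (b x - b y) K(x-y) f(y) dy` (absolutely convergent a.e.) satisfies
`‖C_b f‖_{M^s_l} ≤ C A ‖b‖_{Lip_α} ‖f‖_{M^p_q}`, with `C` depending only on `n, α, p, q`. -/
theorem commutator_strong_Morrey_bound_of_lip (n : ℕ) (α p q s l : ℝ)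
    (hα : 0 < α) (hα1 : α < 1) (hq : 1 < q) (hqp : q ≤ p) (hl : 1 < l) (hls : l ≤ s)
    (hs : 1 / s = 1 / p - α / n) (hlsqp : l / s = q / p) :
    ∃ C : ℝ, 0 < C ∧
      ∀ (A : ℝ) (K : En n → ℂ), Measurable K →
        (∀ z : En n, z ≠ 0 → ‖K z‖ ≤ A * ‖z‖ ^ (-(n : ℝ))) →
        ∀ b : En n → ℝ, lipSeminorm α b < ⊤ →
        ∀ f : En n → ℂ, Measurable f → morreyNorm p q f < ⊤ →
          (∀ᵐ x : En n, Integrable (fun y => ((b x - b y : ℝ) : ℂ) * K (x - y) * f y)) ∧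
          morreyNorm s l (fun x => ∫ y, ((b x - b y : ℝ) : ℂ) * K (x - y) * f y) ≤
            ENNReal.ofReal C * ENNReal.ofReal A * lipSeminorm α b * morreyNorm p q f := by
  rcases Nat.eq_zero_or_pos n with rfl | hn
  · refine ⟨1, one_pos, fun A K _ _ b _ f _ _ => ?_⟩
    have h0 : ∀ x : En 0, (fun y => ((b x - b y : ℝ) : ℂ) * K (x - y) * f y) = fun _ => 0 := by
      intro x
      funext y
      rw [Subsingleton.elim y x]
      simp
    refine ⟨Filter.Eventually.of_forall fun x => by rw [h0 x]; exact integrable_zero _ _ _, ?_⟩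
    simp_rw [h0]
    have hl0 : 0 < l := by linarith
    simp [morreyNorm, hl0]
  have hn1 : (1 : ℝ) ≤ n := by exact_mod_cast hn
  obtain ⟨C, hC, H⟩ := scaled_morrey (n := n) (α := α) (p := p) (q := q) (s := s) (l := l) hn hα hq
    (by linarith) hl (by linarith) hs hlsqp
  have hl0 : 0 < l := by linarith
  have hnα : 0 < (n : ℝ) - α := by linarith
  refine ⟨C * (n - α), by positivity, fun A K hKm hK b hb f hf hfM => ?_⟩
  have hA : 0 ≤ A := by
    have h1 := hK (EuclideanSpace.single ⟨0, hn⟩ 1) (by simp)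
    simp at h1
    exact (norm_nonneg _).trans h1
  set g : (Fin n → ℝ) → ℝ≥0∞ := fun y => ‖f (WithLp.toLp 2 y)‖ₑ with hgd
  have hg : Measurable g := by
    have : Measurable (WithLp.toLp 2 : (Fin n → ℝ) → En n) := WithLp.measurable_toLp 2 _
    exact (hf.comp this).enorm
  have hH := H g hg (fun y => enorm_ne_top) (morreyNorm p q f) hfM.ne (by
    intro c r hr
    have h1 : volume (cube (WithLp.toLp 2 c) r) ^ (1 / p - 1 / q) *
      (∫⁻ y in cube (WithLp.toLp 2 c) r, (‖f y‖₊ : ℝ≥0∞) ^ q) ^ (1 / q) ≤ morreyNorm p q f :=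
      le_iSup_of_le (WithLp.toLp 2 c) (le_iSup_of_le r (le_iSup_of_le hr le_rfl))
    rw [vol_cube _ hr] at h1
    have h2 := int_cube (WithLp.toLp 2 c) hr (F := fun y => g y ^ q) (by fun_prop)
    rw [← h2]
    exact h1)
  have hJm : Measurable (JJ (α - n - 1) g) := meas_near _ hg
  have hJ : ∀ᵐ x, JJ (α - n - 1) g x < ⊤ := JJ_ae_lt_top hl0 hg (ENNReal.mul_ne_top (by simp) hfM.ne) hH
  have hJ' : ∀ᵐ x : En n, JJ (α - n - 1) g (WithLp.ofLp x) < ⊤ :=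
    (PiLp.volume_preserving_ofLp (Fin n)).quasiMeasurePreserving.ae hJ
  set M := ENNReal.ofReal A * lipSeminorm α b * ENNReal.ofReal (n - α) with hMd
  have hM : M ≠ ⊤ := ENNReal.mul_ne_top (ENNReal.mul_ne_top (by simp) hb.ne) (by simp)
  have hbd : ∀ x : En n, ∫⁻ y, ‖((b x - b y : ℝ) : ℂ) * K (x - y) * f y‖ₑ ≤ M * JJ (α - n - 1) g (WithLp.ofLp x) := by
    intro x
    rw [JJ_eq hg]
    have hmeas : Measurable (fun y : Fin n → ℝ => (∫⁻ t in Set.Ioi (dist y (WithLp.ofLp x)), ENNReal.ofReal (t ^ (α - n - 1))) * g y) := by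
      refine Measurable.mul ?_ hg
      have hanti : Antitone (fun d : ℝ => ∫⁻ t in Set.Ioi d, ENNReal.ofReal (t ^ (α - n - 1))) :=
        fun d1 d2 h => lintegral_mono_set (Set.Ioi_subset_Ioi h)
      exact hanti.measurable.comp (by fun_prop)
    rw [← lintegral_const_mul _ hmeas, ← (PiLp.volume_preserving_ofLp (Fin n)).lintegral_comp (hmeas.const_mul M)]
    refine lintegral_mono fun y => ?_
    rw [enorm_mul, ← mul_assoc]
    exact mul_le_mul_left (kernel_bound hn hα hα1 hA hK b x y) _
  have hbm : Measurable b := (lip_cont hα hb).measurable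
  refine ⟨?_, ?_⟩
  · filter_upwards [hJ'] with x hx
    refine ⟨Measurable.aestronglyMeasurable (by fun_prop), ?_⟩
    exact (hbd x).trans_lt (ENNReal.mul_lt_top hM.lt_top hx)
  · refine iSup_le fun c => iSup_le fun r => iSup_le fun hr => ?_
    have h1 : ∫⁻ x in cube c r, (‖∫ y, ((b x - b y : ℝ) : ℂ) * K (x - y) * f y‖₊ : ℝ≥0∞) ^ l ≤
        ∫⁻ x in cube c r, (M * JJ (α - n - 1) g (WithLp.ofLp x)) ^ l := by
      refine lintegral_mono fun x => ENNReal.rpow_le_rpow ?_ hl0.le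
      exact (enorm_integral_le_lintegral_enorm _).trans (hbd x)
    rw [int_cube c hr (F := fun y => (M * JJ (α - n - 1) g y) ^ l) (by fun_prop)] at h1
    rw [vol_cube c hr]
    refine (mul_le_mul_right (ENNReal.rpow_le_rpow h1 (by positivity)) _).trans ?_
    rw [int_smul _ hl0 _ hJm, mul_left_comm]
    refine (mul_le_mul_right (hH _ r hr) _).trans (le_of_eq ?_)
    rw [hMd, ENNReal.ofReal_mul hC.le]
    ring
end
end
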